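/- arXiv:2510.26334 — 9 statements merged into one kernel-verified Lean document; each statement's English description precedes it below -/
import Mathlib

section
/- Define K₁(x) = ∫₀^∞ exp(−x cosh t) cosh t dt for x > 0. Then K₁(r) − 1/r tends to 0 as r tends to 0 from the right. -/
noncomputable section

open Real MeasureTheory Filter Topology

/-- The modified Bessel function of the second kind of order one,
`K₁(x) = ∫₀^∞ exp(−x cosh t) cosh t dt`. -/
def K1 (x : ℝ) : ℝ := ∫ t in Set.Ioi (0 : ℝ), Real.exp (-x * Real.cosh t) * Real.cosh t

theorem Real.tendsto_sinh_atTop : Tendsto Real.sinh atTop atTop :=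
  tendsto_atTop_mono' _ ((eventually_ge_atTop 0).mono fun _ h => Real.self_le_sinh_iff.2 h)
    tendsto_id

theorem hasDerivAt_neg_exp_neg_mul_sinh_div {r : ℝ} (hr : r ≠ 0) (t : ℝ) :
    HasDerivAt (fun t => -(Real.exp (-r * Real.sinh t) / r))
      (Real.exp (-r * Real.sinh t) * Real.cosh t) t := by
  refine (((Real.hasDerivAt_sinh t).const_mul (-r)).exp.div_const r).neg.congr_deriv ?_
  field_simp

theorem tendsto_neg_exp_neg_mul_sinh_div {r : ℝ} (hr : 0 < r) :
    Tendsto (fun t => -(Real.exp (-r * Real.sinh t) / r)) atTop (𝓝 0) := by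
  have h := Real.tendsto_exp_atBot.comp
    (Real.tendsto_sinh_atTop.const_mul_atTop_of_neg (neg_neg_of_pos hr))
  simpa using (h.div_const r).neg

theorem integrableOn_exp_neg_mul_sinh_mul_cosh {r : ℝ} (hr : 0 < r) :
    IntegrableOn (fun t => Real.exp (-r * Real.sinh t) * Real.cosh t) (Set.Ioi 0) :=
  integrableOn_Ioi_deriv_of_nonneg'
    (fun t _ => hasDerivAt_neg_exp_neg_mul_sinh_div hr.ne' t)
    (fun t _ => by have := Real.cosh_pos t; positivity) (tendsto_neg_exp_neg_mul_sinh_div hr)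

theorem integral_exp_neg_mul_sinh_mul_cosh {r : ℝ} (hr : 0 < r) :
    ∫ t in Set.Ioi (0 : ℝ), Real.exp (-r * Real.sinh t) * Real.cosh t = 1 / r := by
  rw [integral_Ioi_of_hasDerivAt_of_tendsto'
    (fun t _ => hasDerivAt_neg_exp_neg_mul_sinh_div hr.ne' t)
    (integrableOn_exp_neg_mul_sinh_mul_cosh hr) (tendsto_neg_exp_neg_mul_sinh_div hr)]
  simp

theorem exp_neg_mul_cosh_le_exp_neg_mul_sinh {r : ℝ} (hr : 0 < r) (t : ℝ) :
    Real.exp (-r * Real.cosh t) ≤ Real.exp (-r * Real.sinh t) :=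
  Real.exp_le_exp.2 (by nlinarith [Real.sinh_lt_cosh t])

theorem integrableOn_exp_neg_mul_cosh_mul_cosh {r : ℝ} (hr : 0 < r) :
    IntegrableOn (fun t => Real.exp (-r * Real.cosh t) * Real.cosh t) (Set.Ioi 0) := by
  refine (integrableOn_exp_neg_mul_sinh_mul_cosh hr).mono'
    (Continuous.aestronglyMeasurable (by fun_prop)) (Eventually.of_forall fun t => ?_)
  have := Real.cosh_pos t
  rw [Real.norm_of_nonneg (by positivity)]
  gcongr ?_ * _
  exact exp_neg_mul_cosh_le_exp_neg_mul_sinh hr t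

/-- `K₁(r) − 1/r` as a single integral, using `1/r = ∫₀^∞ exp(−r sinh t) cosh t dt`. -/
theorem K1_sub_inv_eq_integral {r : ℝ} (hr : 0 < r) :
    K1 r - 1 / r = ∫ t in Set.Ioi (0 : ℝ),
      (Real.exp (-r * Real.cosh t) - Real.exp (-r * Real.sinh t)) * Real.cosh t := by
  rw [K1, ← integral_exp_neg_mul_sinh_mul_cosh hr,
    ← integral_sub (integrableOn_exp_neg_mul_cosh_mul_cosh hr)
      (integrableOn_exp_neg_mul_sinh_mul_cosh hr)]
  simp only [sub_mul]

theorem norm_exp_cosh_sub_exp_sinh_mul_cosh_le {r t : ℝ} (hr : 0 < r) (hr1 : r ≤ 1)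
    (ht : 0 ≤ t) :
    ‖(Real.exp (-r * Real.cosh t) - Real.exp (-r * Real.sinh t)) * Real.cosh t‖
      ≤ 2 * Real.exp (-t) := by
  have hc := Real.cosh_pos t
  have hs : 0 ≤ Real.sinh t := Real.sinh_nonneg_iff.2 ht
  have he1 : Real.exp (-t) ≤ 1 := Real.exp_le_one_iff.2 (by linarith)
  have hmul : Real.exp t * Real.exp (-t) = 1 := by rw [← Real.exp_add]; simp
  have hcosh : Real.cosh t * Real.exp (-t) ≤ 1 := by
    rw [Real.cosh_eq]
    nlinarith [Real.exp_pos (-t)]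
  have hdiff : Real.exp (-r * Real.sinh t) - Real.exp (-r * Real.cosh t)
      ≤ Real.exp (-r * Real.sinh t) * (r * Real.exp (-t)) := by
    have h : Real.exp (-r * Real.cosh t)
        = Real.exp (-r * Real.sinh t) * Real.exp (-(r * Real.exp (-t))) := by
      rw [← Real.exp_add, ← Real.cosh_sub_sinh]
      ring_nf
    rw [h]
    nlinarith [Real.exp_pos (-r * Real.sinh t), Real.add_one_le_exp (-(r * Real.exp (-t)))]
  have hexp : Real.exp (-r * Real.sinh t) * (1 + r * Real.sinh t) ≤ 1 := by
    have h : Real.exp (-r * Real.sinh t) * Real.exp (r * Real.sinh t) = 1 := by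
      rw [← Real.exp_add]; simp
    nlinarith [Real.exp_pos (-r * Real.sinh t), Real.add_one_le_exp (r * Real.sinh t)]
  have hsinh : Real.exp t ≤ 2 * (1 + Real.sinh t) := by
    rw [Real.sinh_eq]
    linarith
  have hbound : r * Real.exp (-r * Real.sinh t) * Real.exp t ≤ 2 := by
    calc r * Real.exp (-r * Real.sinh t) * Real.exp t
        ≤ r * Real.exp (-r * Real.sinh t) * (2 * (1 + Real.sinh t)) := by gcongr
      _ = 2 * (Real.exp (-r * Real.sinh t) * (r + r * Real.sinh t)) := by ring
      _ ≤ 2 * (Real.exp (-r * Real.sinh t) * (1 + r * Real.sinh t)) := by gcongr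
      _ ≤ 2 := by linarith
  rw [norm_mul, Real.norm_of_nonneg hc.le, norm_sub_rev,
    Real.norm_of_nonneg (sub_nonneg.2 (exp_neg_mul_cosh_le_exp_neg_mul_sinh hr t))]
  calc (Real.exp (-r * Real.sinh t) - Real.exp (-r * Real.cosh t)) * Real.cosh t
      ≤ Real.exp (-r * Real.sinh t) * (r * Real.exp (-t)) * Real.cosh t := by gcongr
    _ = r * Real.exp (-r * Real.sinh t) * (Real.cosh t * Real.exp (-t)) := by ring
    _ ≤ r * Real.exp (-r * Real.sinh t) * 1 := by gcongr
    _ = r * Real.exp (-r * Real.sinh t) * Real.exp t * Real.exp (-t) := by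
      rw [mul_assoc _ (Real.exp t), hmul]
    _ ≤ 2 * Real.exp (-t) := by gcongr

/-- `K₁(r) − 1/r → 0` as `r → 0⁺`. -/
theorem K1_sub_inv_tendsto_zero :
    Tendsto (fun r : ℝ => K1 r - 1 / r) (𝓝[>] (0 : ℝ)) (𝓝 0) := by
  have hlim : Tendsto (fun r : ℝ => ∫ t in Set.Ioi (0 : ℝ),
      (Real.exp (-r * Real.cosh t) - Real.exp (-r * Real.sinh t)) * Real.cosh t)
      (𝓝[>] (0 : ℝ)) (𝓝 (∫ _ in Set.Ioi (0 : ℝ), (0 : ℝ))) := by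
    refine tendsto_integral_filter_of_dominated_convergence (fun t => 2 * Real.exp (-t))
      (Eventually.of_forall fun r => Continuous.aestronglyMeasurable (by fun_prop)) ?_
      ((integrableOn_exp_neg_Ioi 0).const_mul 2) (Eventually.of_forall fun t => ?_)
    · filter_upwards [Ioc_mem_nhdsGT (zero_lt_one' ℝ)] with r hr
      filter_upwards [ae_restrict_mem measurableSet_Ioi] with t ht
      exact norm_exp_cosh_sub_exp_sinh_mul_cosh_le hr.1 hr.2 (le_of_lt ht)
    · have h : Continuous fun r : ℝ =>
          (Real.exp (-r * Real.cosh t) - Real.exp (-r * Real.sinh t)) * Real.cosh t := by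
        fun_prop
      simpa using (h.tendsto 0).mono_left nhdsWithin_le_nhds
  rw [integral_zero] at hlim
  refine hlim.congr' ?_
  filter_upwards [self_mem_nhdsWithin] with r hr
  exact (K1_sub_inv_eq_integral hr).symm
end
end

section
/- Define K₀(x) = ∫₀^∞ exp(−x cosh t) dt for x > 0. Then K₀(r) + log r tends to log 2 − γ as r tends to 0 from the right, where γ is the Euler–Mascheroni constant. -/
noncomputable section

open Real MeasureTheory Filter Topology

/-- The modified Bessel function of the second kind of order zero,
`K₀(x) = ∫₀^∞ exp(−x cosh t) dt`. -/
def K0 (x : ℝ) : ℝ := ∫ t in Set.Ioi (0 : ℝ), Real.exp (-x * Real.cosh t)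

lemma integral_log_mul_exp_neg :
    ∫ u in Set.Ioi (0 : ℝ), Real.log u * Real.exp (-u) = -Real.eulerMascheroniConstant := by
  have h1 := Complex.hasDerivAt_GammaIntegral (s := 1) (by simp)
  have h2 : HasDerivAt Complex.GammaIntegral (-(Real.eulerMascheroniConstant : ℂ)) 1 := by
    refine Complex.hasDerivAt_Gamma_one.congr_of_eventuallyEq ?_
    filter_upwards [(isOpen_lt continuous_const Complex.continuous_re).mem_nhds
      (show (0 : ℝ) < (1 : ℂ).re by simp)] with s hs
    exact (Complex.Gamma_eq_integral hs).symm
  have h3 := h1.unique h2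
  simp only [sub_self, Complex.cpow_zero, one_mul] at h3
  rw [← Complex.ofReal_inj, ← integral_complex_ofReal]
  simpa using h3

lemma integrableOn_log_mul_exp_neg :
    IntegrableOn (fun u : ℝ => Real.log u * Real.exp (-u)) (Set.Ioi 0) := by
  refine Integrable.of_integral_ne_zero ?_
  rw [integral_log_mul_exp_neg]
  linarith [Real.one_half_lt_eulerMascheroniConstant]

lemma integrableOn_exp_neg_mul_exp {x : ℝ} (hx : 0 < x) :
    IntegrableOn (fun t : ℝ => Real.exp (-(x * Real.exp t))) (Set.Ioi 0) := by
  refine (exp_neg_integrableOn_Ioi 0 hx).mono' (by fun_prop) (ae_of_all _ fun t => ?_)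
  rw [Real.norm_of_nonneg (Real.exp_pos _).le, Real.exp_le_exp]
  nlinarith [Real.add_one_le_exp t]

lemma integrableOn_exp_neg_mul_cosh {x : ℝ} (hx : 0 < x) :
    IntegrableOn (fun t : ℝ => Real.exp (-x * Real.cosh t)) (Set.Ioi 0) := by
  refine (integrableOn_exp_neg_mul_exp (half_pos hx)).mono' (by fun_prop)
    (ae_of_all _ fun t => ?_)
  rw [Real.norm_of_nonneg (Real.exp_pos _).le, Real.exp_le_exp, Real.cosh_eq]
  nlinarith [mul_pos hx (Real.exp_pos (-t))]

lemma integrableOn_inv_mul_exp_neg {x : ℝ} (hx : 0 < x) :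
    IntegrableOn (fun u : ℝ => u⁻¹ * Real.exp (-u)) (Set.Ioi x) := by
  refine ((integrableOn_exp_neg_Ioi x).const_mul x⁻¹).mono' (by fun_prop) ?_
  filter_upwards [ae_restrict_mem measurableSet_Ioi] with u hu
  have hu' : x < u := hu
  have : 0 < u := hx.trans hu'
  rw [Real.norm_of_nonneg (by positivity)]
  gcongr

lemma integral_exp_neg_mul_exp_eq_integral_inv_mul_exp_neg {x : ℝ} (hx : 0 < x) :
    ∫ t in Set.Ioi (0 : ℝ), Real.exp (-(x * Real.exp t)) =
      ∫ u in Set.Ioi x, u⁻¹ * Real.exp (-u) := by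
  have hcancel : ∀ t : ℝ, ((fun u : ℝ => u⁻¹ * Real.exp (-u)) ∘ fun t => x * Real.exp t) t *
      (x * Real.exp t) = Real.exp (-(x * Real.exp t)) := fun t => by
    have : x * Real.exp t ≠ 0 := (mul_pos hx (Real.exp_pos t)).ne'
    simp only [Function.comp_apply]
    field_simp
  have h := integral_comp_mul_deriv_Ioi (f := fun t => x * Real.exp t)
    (f' := fun t => x * Real.exp t) (g := fun u => u⁻¹ * Real.exp (-u)) (a := 0)
    (by fun_prop) (Real.tendsto_exp_atTop.const_mul_atTop hx)
    (fun t _ => ((Real.hasDerivAt_exp t).const_mul x).hasDerivWithinAt) ?_ ?_ ?_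
  · simpa only [hcancel, Real.exp_zero, mul_one] using h
  · refine ContinuousOn.mul (continuousOn_inv₀.mono ?_) (by fun_prop)
    rintro _ ⟨t, -, rfl⟩
    exact (mul_pos hx (Real.exp_pos t)).ne'
  · refine (integrableOn_Ici_iff_integrableOn_Ioi enorm_ne_top).2
      (integrableOn_inv_mul_exp_neg hx) |>.mono_set ?_
    rintro _ ⟨t, ht, rfl⟩
    exact le_mul_of_one_le_right hx.le (Real.one_le_exp ht)
  · simp only [hcancel]
    exact (integrableOn_Ici_iff_integrableOn_Ioi enorm_ne_top).2 (integrableOn_exp_neg_mul_exp hx)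

lemma tendsto_log_mul_exp_neg_atTop :
    Tendsto (fun u : ℝ => Real.log u * Real.exp (-u)) atTop (𝓝 0) := by
  have h := Real.tendsto_pow_mul_exp_neg_atTop_nhds_zero 1
  refine squeeze_zero' ?_ ?_ h
  · filter_upwards [eventually_ge_atTop 1] with u hu
    exact mul_nonneg (Real.log_nonneg hu) (Real.exp_pos _).le
  · filter_upwards [eventually_ge_atTop 1] with u hu
    rw [pow_one]
    gcongr
    exact Real.log_le_self (by linarith)

lemma integral_inv_mul_exp_neg_add_log {x : ℝ} (hx : 0 < x) :
    (∫ u in Set.Ioi x, u⁻¹ * Real.exp (-u)) + Real.log x * Real.exp (-x) =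
      ∫ u in Set.Ioi x, Real.log u * Real.exp (-u) := by
  have hi := integrableOn_inv_mul_exp_neg hx
  have hl := integrableOn_log_mul_exp_neg.mono_set (Set.Ioi_subset_Ioi hx.le)
  have h := integral_Ioi_of_hasDerivAt_of_tendsto' (a := x)
    (f := fun u => Real.log u * Real.exp (-u))
    (f' := fun u => u⁻¹ * Real.exp (-u) - Real.log u * Real.exp (-u))
    (fun u hu => ?_) (hi.sub hl) tendsto_log_mul_exp_neg_atTop
  · rw [integral_sub hi hl] at h
    linarith
  · have hu0 : u ≠ 0 := (hx.trans_le hu).ne'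
    convert! (Real.hasDerivAt_log hu0).mul (hasDerivAt_neg u).exp using 1
    ring

lemma tendsto_integral_Ioi_log_mul_exp_neg :
    Tendsto (fun x : ℝ => ∫ u in Set.Ioi x, Real.log u * Real.exp (-u)) (𝓝[>] 0)
      (𝓝 (-Real.eulerMascheroniConstant)) := by
  have hc : AECover (volume.restrict (Set.Ioi (0 : ℝ))) (𝓝[>] (0 : ℝ)) fun x => Set.Ioi x :=
    aecover_Ioi_of_Ioi (tendsto_nhdsWithin_of_tendsto_nhds tendsto_id)
  have h := hc.integral_tendsto_of_countably_generated integrableOn_log_mul_exp_neg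
  rw [integral_log_mul_exp_neg] at h
  refine h.congr' ?_
  filter_upwards [self_mem_nhdsWithin] with x hx
  rw [Measure.restrict_restrict measurableSet_Ioi,
    Set.inter_eq_left.2 (Set.Ioi_subset_Ioi (le_of_lt hx))]

lemma tendsto_one_sub_exp_neg_mul_log :
    Tendsto (fun x : ℝ => (1 - Real.exp (-x)) * Real.log x) (𝓝[>] 0) (𝓝 0) := by
  have h := (tendsto_log_mul_rpow_nhdsGT_zero zero_lt_one).norm
  rw [norm_zero] at h
  refine squeeze_zero_norm' ?_ h
  filter_upwards [self_mem_nhdsWithin] with x hx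
  have hx' : 0 < x := hx
  rw [Real.rpow_one, norm_mul, norm_mul, mul_comm]
  gcongr
  rw [Real.norm_of_nonneg hx'.le, Real.norm_of_nonneg (by simp [hx'.le])]
  linarith [Real.add_one_le_exp (-x)]

lemma tendsto_integral_exp_neg_mul_exp_add_log :
    Tendsto (fun x : ℝ => (∫ t in Set.Ioi (0 : ℝ), Real.exp (-(x * Real.exp t))) + Real.log x)
      (𝓝[>] 0) (𝓝 (-Real.eulerMascheroniConstant)) := by
  have h := tendsto_integral_Ioi_log_mul_exp_neg.add tendsto_one_sub_exp_neg_mul_log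
  rw [add_zero] at h
  refine h.congr' ?_
  filter_upwards [self_mem_nhdsWithin] with x hx
  rw [← integral_inv_mul_exp_neg_add_log hx,
    integral_exp_neg_mul_exp_eq_integral_inv_mul_exp_neg hx]
  ring

lemma abs_K0_sub_integral_exp_neg_mul_exp_le {r : ℝ} (hr : 0 < r) :
    |K0 r - ∫ t in Set.Ioi (0 : ℝ), Real.exp (-(r / 2 * Real.exp t))| ≤ r / 2 := by
  rw [K0, ← integral_sub (integrableOn_exp_neg_mul_cosh hr)
    (integrableOn_exp_neg_mul_exp (half_pos hr)), ← Real.norm_eq_abs]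
  have hbound : ∀ t : ℝ, ‖Real.exp (-r * Real.cosh t) - Real.exp (-(r / 2 * Real.exp t))‖ ≤
      r / 2 * Real.exp (-t) := fun t => by
    have hsplit : Real.exp (-r * Real.cosh t) =
        Real.exp (-(r / 2 * Real.exp t)) * Real.exp (-(r / 2 * Real.exp (-t))) := by
      rw [← Real.exp_add, Real.cosh_eq]
      congr 1
      ring
    have ha : Real.exp (-(r / 2 * Real.exp t)) ≤ 1 := by
      rw [Real.exp_le_one_iff, neg_nonpos]
      positivity
    have hp : 0 < r / 2 * Real.exp (-t) := by positivity
    have hb : Real.exp (-(r / 2 * Real.exp (-t))) ≤ 1 := by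
      rw [Real.exp_le_one_iff]
      linarith
    have hb' := Real.add_one_le_exp (-(r / 2 * Real.exp (-t)))
    have h0 := Real.exp_pos (-(r / 2 * Real.exp t))
    rw [hsplit, Real.norm_eq_abs, abs_le]
    constructor <;> nlinarith
  refine (norm_integral_le_of_norm_le ((integrableOn_exp_neg_Ioi 0).const_mul (r / 2))
    (ae_of_all _ hbound)).trans_eq ?_
  rw [integral_const_mul, integral_exp_neg_Ioi_zero, mul_one]

/-- `K₀(r) + log r → log 2 − γ` as `r → 0⁺`, where `γ` is the Euler–Mascheroni constant. -/
theorem K0_add_log_tendsto :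
    Tendsto (fun r : ℝ => K0 r + Real.log r) (𝓝[>] (0 : ℝ))
      (𝓝 (Real.log 2 - Real.eulerMascheroniConstant)) := by
  have hid : Tendsto (fun r : ℝ => r / 2) (𝓝[>] 0) (𝓝 0) := by
    refine tendsto_nhdsWithin_of_tendsto_nhds ?_
    simpa using (tendsto_id (x := 𝓝 (0 : ℝ))).div_const 2
  have hhalf : Tendsto (fun r : ℝ => r / 2) (𝓝[>] 0) (𝓝[>] 0) :=
    tendsto_nhdsWithin_iff.2 ⟨hid, by
      filter_upwards [self_mem_nhdsWithin] with r hr using half_pos (Set.mem_Ioi.1 hr)⟩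
  have hdiff : Tendsto
      (fun r : ℝ => K0 r - ∫ t in Set.Ioi (0 : ℝ), Real.exp (-(r / 2 * Real.exp t)))
      (𝓝[>] 0) (𝓝 0) := by
    refine squeeze_zero_norm' ?_ hid
    filter_upwards [self_mem_nhdsWithin] with r hr
    exact abs_K0_sub_integral_exp_neg_mul_exp_le hr
  have h := (hdiff.add (tendsto_integral_exp_neg_mul_exp_add_log.comp hhalf)).add_const
    (Real.log 2)
  rw [zero_add, neg_add_eq_sub] at h
  refine h.congr' ?_
  filter_upwards [self_mem_nhdsWithin] with r hr
  simp only [Function.comp_apply]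
  rw [Real.log_div (ne_of_gt hr) two_ne_zero]
  ring
end
end

section
/- For every smooth compactly supported function φ : ℝ² → ℝ, one has (1/(2π)) ∫_{ℝ²} log|x| · Δφ(x) dx = φ(0), i.e., (1/(2π)) log|x| is a fundamental solution of the Laplacian in two dimensions. -/
noncomputable section

open Real MeasureTheory

/-- The Laplacian `Δf = ∂₁²f + ∂₂²f` of a real-valued function on `ℝ²`. -/
def lap (f : EuclideanSpace ℝ (Fin 2) → ℝ) (x : EuclideanSpace ℝ (Fin 2)) : ℝ :=
  ∑ i : Fin 2,
    fderiv ℝ (fun y => fderiv ℝ f y (EuclideanSpace.single i 1)) x (EuclideanSpace.single i 1)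

open Filter Topology

lemma continuous_fderiv_fderiv_apply {u : EuclideanSpace ℝ (Fin 2) → ℝ} (hu : ContDiff ℝ 2 u)
    (v : EuclideanSpace ℝ (Fin 2)) :
    Continuous (fun x => fderiv ℝ (fun y => fderiv ℝ u y v) x v) :=
  (((hu.fderiv_right (m := 1) (by norm_num)).clm_apply contDiff_const).continuous_fderiv
    (by norm_num)).clm_apply continuous_const

lemma integral_mul_fderiv_fderiv_eq {u φ : EuclideanSpace ℝ (Fin 2) → ℝ}
    (hu : ContDiff ℝ 2 u) (hφ : ContDiff ℝ 2 φ) (hsupp : HasCompactSupport φ)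
    (v : EuclideanSpace ℝ (Fin 2)) :
    ∫ x, u x * fderiv ℝ (fun y => fderiv ℝ φ y v) x v =
      ∫ x, fderiv ℝ (fun y => fderiv ℝ u y v) x v * φ x := by
  have hu' : ContDiff ℝ 1 (fun y => fderiv ℝ u y v) :=
    (hu.fderiv_right (m := 1) (by norm_num)).clm_apply contDiff_const
  have hφ' : ContDiff ℝ 1 (fun y => fderiv ℝ φ y v) :=
    (hφ.fderiv_right (m := 1) (by norm_num)).clm_apply contDiff_const
  have hu'' := continuous_fderiv_fderiv_apply hu v
  have hφ'' := continuous_fderiv_fderiv_apply hφ v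
  have hs' : HasCompactSupport (fun y => fderiv ℝ φ y v) := hsupp.fderiv_apply ℝ v
  have hs'' : HasCompactSupport (fun x => fderiv ℝ (fun y => fderiv ℝ φ y v) x v) :=
    hs'.fderiv_apply ℝ v
  have hint : Integrable (fun x => fderiv ℝ u x v * fderiv ℝ φ x v) :=
    (hu'.continuous.mul hφ'.continuous).integrable_of_hasCompactSupport hs'.mul_left
  rw [integral_mul_fderiv_eq_neg_fderiv_mul_of_integrable hint
    ((hu.continuous.mul hφ'').integrable_of_hasCompactSupport hs''.mul_left)
    ((hu.continuous.mul hφ'.continuous).integrable_of_hasCompactSupport hs'.mul_left)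
    (fun x _ => hu.differentiable (by norm_num) x)
    (fun x _ => hφ'.differentiable (by norm_num) x),
    integral_mul_fderiv_eq_neg_fderiv_mul_of_integrable
    ((hu''.mul hφ.continuous).integrable_of_hasCompactSupport hsupp.mul_left) hint
    ((hu'.continuous.mul hφ.continuous).integrable_of_hasCompactSupport hsupp.mul_left)
    (fun x _ => hu'.differentiable (by norm_num) x)
    (fun x _ => hφ.differentiable (by norm_num) x), neg_neg]

lemma continuous_lap {u : EuclideanSpace ℝ (Fin 2) → ℝ} (hu : ContDiff ℝ 2 u) :
    Continuous (lap u) :=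
  continuous_finsetSum _ fun _ _ => continuous_fderiv_fderiv_apply hu _

lemma hasCompactSupport_lap {φ : EuclideanSpace ℝ (Fin 2) → ℝ} (hφ : HasCompactSupport φ) :
    HasCompactSupport (lap φ) := by
  have h (i : Fin 2) := (hφ.fderiv_apply ℝ (EuclideanSpace.single i 1)).fderiv_apply ℝ
    (EuclideanSpace.single i 1)
  have e : lap φ = fun x => _ + _ := funext fun x => Fin.sum_univ_two _
  rw [e]
  exact (h 0).add (h 1)

/-- Green's second identity on the plane, against a compactly supported function. -/
lemma integral_mul_lap_eq {u φ : EuclideanSpace ℝ (Fin 2) → ℝ}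
    (hu : ContDiff ℝ 2 u) (hφ : ContDiff ℝ 2 φ) (hsupp : HasCompactSupport φ) :
    ∫ x, u x * lap φ x = ∫ x, lap u x * φ x := by
  simp only [lap, Finset.mul_sum, Finset.sum_mul]
  rw [integral_finsetSum, integral_finsetSum]
  · exact Finset.sum_congr rfl fun i _ => integral_mul_fderiv_fderiv_eq hu hφ hsupp _
  · exact fun i _ => ((continuous_fderiv_fderiv_apply hu _).mul
      hφ.continuous).integrable_of_hasCompactSupport hsupp.mul_left
  · exact fun i _ => (hu.continuous.mul
      (continuous_fderiv_fderiv_apply hφ _)).integrable_of_hasCompactSupport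
      ((hsupp.fderiv_apply ℝ _).fderiv_apply ℝ _).mul_left

lemma contDiff_log_norm_sq_add {δ : ℝ} (hδ : 0 < δ) :
    ContDiff ℝ 2 (fun x : EuclideanSpace ℝ (Fin 2) => Real.log (‖x‖ ^ 2 + δ) / 2) :=
  (((contDiff_norm_sq ℝ).add contDiff_const).log fun x => by positivity).div_const 2

lemma lap_log_norm_sq_add {δ : ℝ} (hδ : 0 < δ) (x : EuclideanSpace ℝ (Fin 2)) :
    lap (fun x => Real.log (‖x‖ ^ 2 + δ) / 2) x = 2 * δ / (‖x‖ ^ 2 + δ) ^ 2 := by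
  have hne (y : EuclideanSpace ℝ (Fin 2)) : ‖y‖ ^ 2 + δ ≠ 0 := by positivity
  have hsq (y : EuclideanSpace ℝ (Fin 2)) :
      HasFDerivAt (fun y : EuclideanSpace ℝ (Fin 2) => ‖y‖ ^ 2 + δ) (2 • innerSL ℝ y) y :=
    (hasStrictFDerivAt_norm_sq y).hasFDerivAt.add_const δ
  have h1 (i : Fin 2) (y : EuclideanSpace ℝ (Fin 2)) :
      fderiv ℝ (fun x : EuclideanSpace ℝ (Fin 2) => Real.log (‖x‖ ^ 2 + δ) / 2) y
        (EuclideanSpace.single i 1) = y i * (‖y‖ ^ 2 + δ)⁻¹ := by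
    have := ((hsq y).log (hne y)).mul_const (2⁻¹ : ℝ)
    simp only [← div_eq_mul_inv] at this
    rw [this.fderiv]
    simp [EuclideanSpace.inner_single_right]
    ring
  have h2 (i : Fin 2) :
      fderiv ℝ (fun y : EuclideanSpace ℝ (Fin 2) => y i * (‖y‖ ^ 2 + δ)⁻¹) x
        (EuclideanSpace.single i 1) =
        (‖x‖ ^ 2 + δ)⁻¹ - 2 * x i ^ 2 / (‖x‖ ^ 2 + δ) ^ 2 := by
    have hinv := (hasDerivAt_inv (hne x)).comp_hasFDerivAt x (hsq x)
    have hcoord : HasFDerivAt (fun y : EuclideanSpace ℝ (Fin 2) => y i)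
        (EuclideanSpace.proj i : EuclideanSpace ℝ (Fin 2) →L[ℝ] ℝ) x :=
      (EuclideanSpace.proj i : EuclideanSpace ℝ (Fin 2) →L[ℝ] ℝ).hasFDerivAt
    have h := (hcoord.mul hinv).fderiv
    simp only [Pi.mul_def, Function.comp_def] at h
    rw [h]
    simp [EuclideanSpace.inner_single_right]
    ring
  have hn : ‖x‖ ^ 2 = x 0 ^ 2 + x 1 ^ 2 := by simp [EuclideanSpace.norm_sq_eq]
  simp only [lap, h1, h2, Fin.sum_univ_two]
  have := hne x
  field_simp
  rw [hn]
  ring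

lemma integral_inv_one_add_norm_sq_sq :
    ∫ x : EuclideanSpace ℝ (Fin 2), π⁻¹ * ((1 + ‖x‖ ^ 2) ^ 2)⁻¹ = 1 := by
  rw [integral_fun_norm_addHaar volume (fun r : ℝ => π⁻¹ * ((1 + r ^ 2) ^ 2)⁻¹)]
  have hb : volume.real (Metric.ball (0 : EuclideanSpace ℝ (Fin 2)) 1) = π := by
    rw [measureReal_def, InnerProductSpace.volume_ball_of_dim_even (k := 1) (by simp)]
    simp [pi_nonneg]
  have hI : ∫ r in Set.Ioi (0 : ℝ), r * ((1 + r ^ 2) ^ 2)⁻¹ = 1 / 2 := by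
    have hd (r : ℝ) : HasDerivAt (fun r : ℝ => -(1 + r ^ 2)⁻¹ / 2) (r * ((1 + r ^ 2) ^ 2)⁻¹) r := by
      have hne : 1 + r ^ 2 ≠ 0 := by positivity
      convert! ((((hasDerivAt_id r).pow 2).const_add 1).inv hne).neg.div_const 2 using 1
      simp
      field_simp
    have ht : Tendsto (fun r : ℝ => -(1 + r ^ 2)⁻¹ / 2) atTop (𝓝 0) := by
      have : Tendsto (fun r : ℝ => (1 + r ^ 2)⁻¹) atTop (𝓝 0) :=
        (tendsto_atTop_add_const_left _ 1 (tendsto_pow_atTop two_ne_zero)).inv_tendsto_atTop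
      simpa using this.neg.div_const 2
    rw [integral_Ioi_of_hasDerivAt_of_nonneg' (fun r _ => hd r) _ ht]
    · norm_num
    · intro r (hr : 0 < r)
      positivity
  rw [hb]
  simp only [finrank_euclideanSpace, Fintype.card_fin, Nat.add_one_sub_one, pow_one, smul_eq_mul,
    mul_left_comm _ π⁻¹, integral_const_mul, hI]
  have := pi_ne_zero
  simp

lemma tendsto_norm_sq_mul_inv_one_add_norm_sq_sq :
    Tendsto (fun x : EuclideanSpace ℝ (Fin 2) => ‖x‖ ^ 2 * (π⁻¹ * ((1 + ‖x‖ ^ 2) ^ 2)⁻¹))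
      (Bornology.cobounded _) (𝓝 0) := by
  have h : Tendsto (fun x : EuclideanSpace ℝ (Fin 2) => π⁻¹ * (1 + ‖x‖ ^ 2)⁻¹)
      (Bornology.cobounded _) (𝓝 0) := by
    have := ((tendsto_atTop_add_const_left _ 1 (tendsto_pow_atTop (α := ℝ) two_ne_zero)).comp
      (tendsto_norm_cobounded_atTop (E := EuclideanSpace ℝ (Fin 2)))).inv_tendsto_atTop
    simpa using this.const_mul π⁻¹
  refine squeeze_zero (fun x => by positivity) (fun x => ?_) h
  have hp : 0 < 1 + ‖x‖ ^ 2 := by positivity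
  have hle : ‖x‖ ^ 2 * ((1 + ‖x‖ ^ 2) ^ 2)⁻¹ ≤ (1 + ‖x‖ ^ 2)⁻¹ := by
    field_simp
    linarith
  rw [mul_left_comm]
  gcongr

lemma locallyIntegrable_log_norm :
    LocallyIntegrable (fun x : EuclideanSpace ℝ (Fin 2) => Real.log ‖x‖) := by
  intro x
  refine ⟨Metric.ball 0 (‖x‖ + 1), Metric.isOpen_ball.mem_nhds (by simp), ?_⟩
  rw [integrableOn_fun_norm_addHaar volume (f := Real.log)]
  have hc : Continuous (fun r : ℝ => r ^ (Module.finrank ℝ (EuclideanSpace ℝ (Fin 2)) - 1) •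
      Real.log r) := by
    simpa using Real.continuous_mul_log
  exact (hc.integrableOn_Icc (a := 0) (b := ‖x‖ + 1)).mono_set Set.Ioo_subset_Icc_self

lemma abs_log_norm_sq_add_le {x : EuclideanSpace ℝ (Fin 2)} (hx : x ≠ 0) {δ : ℝ} (hδ : 0 ≤ δ)
    (hδ1 : δ ≤ 1) :
    |Real.log (‖x‖ ^ 2 + δ) / 2| ≤ |Real.log ‖x‖| + Real.log (‖x‖ ^ 2 + 1) / 2 := by
  have hx' : 0 < ‖x‖ := norm_pos_iff.mpr hx
  have h1 : Real.log (‖x‖ ^ 2) ≤ Real.log (‖x‖ ^ 2 + δ) := Real.log_le_log (by positivity) (by simpa)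
  have h2 : Real.log (‖x‖ ^ 2 + δ) ≤ Real.log (‖x‖ ^ 2 + 1) :=
    Real.log_le_log (by positivity) (by gcongr)
  have h3 : 0 ≤ Real.log (‖x‖ ^ 2 + 1) := Real.log_nonneg (by nlinarith)
  rw [Real.log_pow] at h1
  push_cast at h1
  rw [abs_le]
  constructor <;> linarith [neg_abs_le (Real.log ‖x‖), abs_nonneg (Real.log ‖x‖)]

lemma tendsto_integral_log_norm_sq_add_mul {g : EuclideanSpace ℝ (Fin 2) → ℝ} (hg : Continuous g)
    (hsupp : HasCompactSupport g) :
    Tendsto (fun c : ℝ => ∫ x, Real.log (‖x‖ ^ 2 + (c ^ 2)⁻¹) / 2 * g x) atTop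
      (𝓝 (∫ x, Real.log ‖x‖ * g x)) := by
  have hlim : Tendsto (fun c : ℝ => (c ^ 2)⁻¹) atTop (𝓝 0) :=
    (tendsto_pow_atTop two_ne_zero).inv_tendsto_atTop
  have hae : ∀ᵐ x : EuclideanSpace ℝ (Fin 2), x ≠ 0 := Measure.ae_ne volume 0
  refine tendsto_integral_filter_of_dominated_convergence
    (fun x => (|Real.log ‖x‖| + Real.log (‖x‖ ^ 2 + 1) / 2) * |g x|) ?_ ?_ ?_ ?_
  · exact .of_forall fun c => Measurable.aestronglyMeasurable (by
      have := hg.measurable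
      fun_prop)
  · filter_upwards [eventually_ge_atTop 1] with c hc
    filter_upwards [hae] with x hx
    rw [norm_mul, Real.norm_eq_abs, Real.norm_eq_abs]
    gcongr
    exact abs_log_norm_sq_add_le hx (by positivity) (inv_le_one_of_one_le₀ (one_le_pow₀ hc))
  · have h := (contDiff_log_norm_sq_add one_pos).continuous.locallyIntegrable (μ := volume)
    simpa using (LocallyIntegrable.add (f := fun x => |Real.log ‖x‖|)
      (fun x => (locallyIntegrable_log_norm x).norm) h).integrable_smul_right_of_hasCompactSupport
      hg.abs (hsupp.comp_left (g := abs) abs_zero)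
  · filter_upwards [hae] with x hx
    have hx' : ‖x‖ ^ 2 ≠ 0 := by simpa using hx
    have h : Tendsto (fun c : ℝ => ‖x‖ ^ 2 + (c ^ 2)⁻¹) atTop (𝓝 (‖x‖ ^ 2)) := by
      simpa using hlim.const_add (‖x‖ ^ 2)
    have := ((h.log hx').div_const 2).mul_const (g x)
    simpa [Real.log_pow] using this

/-- `(1/(2π)) log |x|` is a fundamental solution of the Laplacian in two dimensions:
for every smooth compactly supported `φ`, `(1/(2π)) ∫ log|x| Δφ(x) dx = φ(0)`. -/
theorem log_fundamental_solution_laplacian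
    (φ : EuclideanSpace ℝ (Fin 2) → ℝ) (hφ : ContDiff ℝ (⊤ : ℕ∞) φ) (hsupp : HasCompactSupport φ) :
    (1 / (2 * Real.pi)) * ∫ x : EuclideanSpace ℝ (Fin 2), Real.log ‖x‖ * lap φ x = φ 0 := by
  have hφ2 : ContDiff ℝ 2 φ := contDiff_infty.mp hφ 2
  have hlog := tendsto_integral_log_norm_sq_add_mul (continuous_lap hφ2)
    (hasCompactSupport_lap hsupp)
  have hpeak := (tendsto_integral_comp_smul_smul_of_integrable
    (μ := (volume : Measure (EuclideanSpace ℝ (Fin 2))))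
    (φ := fun x => π⁻¹ * ((1 + ‖x‖ ^ 2) ^ 2)⁻¹) (fun x => by positivity)
    integral_inv_one_add_norm_sq_sq
    (by simpa using tendsto_norm_sq_mul_inv_one_add_norm_sq_sq)
    (hφ.continuous.integrable_of_hasCompactSupport hsupp) hφ.continuous.continuousAt).const_mul
    (2 * π)
  have heq : (fun c : ℝ => ∫ x, Real.log (‖x‖ ^ 2 + (c ^ 2)⁻¹) / 2 * lap φ x) =ᶠ[atTop]
      fun c => 2 * π * ∫ x : EuclideanSpace ℝ (Fin 2),
        (c ^ Module.finrank ℝ (EuclideanSpace ℝ (Fin 2)) *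
          (π⁻¹ * ((1 + ‖c • x‖ ^ 2) ^ 2)⁻¹)) • φ x := by
    filter_upwards [eventually_gt_atTop 0] with c hc
    have hδ : 0 < (c ^ 2)⁻¹ := by positivity
    rw [integral_mul_lap_eq (contDiff_log_norm_sq_add hδ) hφ2 hsupp, ← integral_const_mul]
    congr 1 with x
    rw [lap_log_norm_sq_add hδ, norm_smul, Real.norm_eq_abs, mul_pow, sq_abs,
      finrank_euclideanSpace, Fintype.card_fin, smul_eq_mul]
    have := pi_ne_zero
    have h1 : 1 + c ^ 2 * ‖x‖ ^ 2 ≠ 0 := by positivity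
    have h2 : ‖x‖ ^ 2 + (c ^ 2)⁻¹ = (1 + c ^ 2 * ‖x‖ ^ 2) / c ^ 2 := by
      field_simp
      ring
    rw [h2]
    field_simp
  rw [tendsto_nhds_unique hlog (hpeak.congr' heq.symm)]
  have := pi_ne_zero
  field_simp
end
end

section
/- Define K₀(x) = ∫₀^∞ exp(−x cosh t) dt for x > 0. Then for every smooth compactly supported function φ : ℝ² → ℝ, one has −(1/(2π)) ∫_{ℝ²} K₀(|x|) · (Δφ(x) − φ(x)) dx = φ(0), i.e., −(1/(2π)) K₀(|x|) is a fundamental solution of the operator Δ − 1 in two dimensions. -/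
noncomputable section

open Real MeasureTheory

local notation "ℝ²" => EuclideanSpace ℝ (Fin 2)

section IntegrationByParts

/-- Green's second identity without boundary terms, for a compactly supported factor. -/
lemma integral_mul_lap_eq_integral_lap_mul {g φ : ℝ² → ℝ} (hg : ContDiff ℝ 2 g)
    (hφ : ContDiff ℝ 2 φ) (hsupp : HasCompactSupport φ) :
    ∫ x, g x * lap φ x = ∫ x, lap g x * φ x := by
  have deriv_contDiff {f : ℝ² → ℝ} (hf : ContDiff ℝ 2 f) (i : Fin 2) :
      ContDiff ℝ 1 (fun y => fderiv ℝ f y (EuclideanSpace.single i 1)) :=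
    (hf.fderiv_right (m := 1) (by norm_num)).clm_apply contDiff_const
  have second_continuous {f : ℝ² → ℝ} (hf : ContDiff ℝ 2 f) (i : Fin 2) :
      Continuous (fun x => fderiv ℝ (fun y => fderiv ℝ f y (EuclideanSpace.single i 1)) x
        (EuclideanSpace.single i 1)) :=
    ((deriv_contDiff hf i).continuous_fderiv (by norm_num)).clm_apply continuous_const
  have supp1 (i : Fin 2) :
      HasCompactSupport (fun y => fderiv ℝ φ y (EuclideanSpace.single i 1)) :=
    hsupp.fderiv_apply ℝ _
  have supp2 (i : Fin 2) :
      HasCompactSupport (fun x => fderiv ℝ (fun y => fderiv ℝ φ y (EuclideanSpace.single i 1)) x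
        (EuclideanSpace.single i 1)) :=
    (supp1 i).fderiv_apply ℝ _
  have integrable_mul {u v : ℝ² → ℝ} (hu : Continuous u) (hv : Continuous v)
      (hv' : HasCompactSupport v) : Integrable (fun x => u x * v x) :=
    (hu.mul hv).integrable_of_hasCompactSupport hv'.mul_left
  have int1 (i : Fin 2) := integrable_mul hg.continuous (second_continuous hφ i) (supp2 i)
  have int2 (i : Fin 2) := integrable_mul (second_continuous hg i) hφ.continuous hsupp
  have int3 (i : Fin 2) :=
    integrable_mul (deriv_contDiff hg i).continuous (deriv_contDiff hφ i).continuous (supp1 i)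
  simp only [lap, Finset.mul_sum, Finset.sum_mul]
  rw [integral_finsetSum _ fun i _ => int1 i, integral_finsetSum _ fun i _ => int2 i]
  refine Finset.sum_congr rfl fun i _ => ?_
  rw [integral_mul_fderiv_eq_neg_fderiv_mul_of_integrable (int3 i) (int1 i)
    (integrable_mul hg.continuous (deriv_contDiff hφ i).continuous (supp1 i))
    (fun x _ => (hg.differentiable (by norm_num)).differentiableAt)
    (fun x _ => ((deriv_contDiff hφ i).differentiable (by norm_num)).differentiableAt),
    integral_mul_fderiv_eq_neg_fderiv_mul_of_integrable (int2 i) (int3 i)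
    (integrable_mul (deriv_contDiff hg i).continuous hφ.continuous hsupp)
    (fun x _ => ((deriv_contDiff hg i).differentiable (by norm_num)).differentiableAt)
    (fun x _ => (hφ.differentiable (by norm_num)).differentiableAt), neg_neg]

end IntegrationByParts

section RegularizedExponential

lemma hasFDerivAt_sqrt_norm_sq_add {ε : ℝ} (hε : 0 < ε) (x : ℝ²) :
    HasFDerivAt (fun y : ℝ² => √(‖y‖ ^ 2 + ε)) ((√(‖x‖ ^ 2 + ε))⁻¹ • innerSL ℝ x) x := by
  have h := ((hasStrictFDerivAt_norm_sq x).hasFDerivAt.add_const ε).sqrt (by positivity)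
  refine h.congr_fderiv ?_
  ext v
  simp only [smul_apply, nsmul_eq_mul, smul_eq_mul]
  push_cast
  field_simp

lemma contDiff_exp_neg_mul_sqrt {ε : ℝ} (hε : 0 < ε) (c : ℝ) :
    ContDiff ℝ 2 (fun y : ℝ² => exp (-c * √(‖y‖ ^ 2 + ε))) :=
  (contDiff_const.mul (((contDiff_norm_sq ℝ).add contDiff_const).sqrt
    fun x => by positivity)).exp

lemma fderiv_exp_neg_mul_sqrt_single {ε : ℝ} (hε : 0 < ε) (c : ℝ) (x : ℝ²) (i : Fin 2) :
    fderiv ℝ (fun y : ℝ² => exp (-c * √(‖y‖ ^ 2 + ε))) x (EuclideanSpace.single i 1) =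
      -c * (x i * ((√(‖x‖ ^ 2 + ε))⁻¹ * exp (-c * √(‖x‖ ^ 2 + ε)))) := by
  rw [((hasFDerivAt_sqrt_norm_sq_add hε x).const_mul (-c)).exp.fderiv]
  simp [EuclideanSpace.inner_single_right]
  ring

lemma lap_exp_neg_mul_sqrt {ε : ℝ} (hε : 0 < ε) (c : ℝ) (x : ℝ²) :
    lap (fun y : ℝ² => exp (-c * √(‖y‖ ^ 2 + ε))) x =
      (c ^ 2 * (‖x‖ ^ 2 / (‖x‖ ^ 2 + ε)) -
        c * (√(‖x‖ ^ 2 + ε))⁻¹ * (2 - ‖x‖ ^ 2 / (‖x‖ ^ 2 + ε))) *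
        exp (-c * √(‖x‖ ^ 2 + ε)) := by
  have hs : 0 < √(‖x‖ ^ 2 + ε) := sqrt_pos.2 (by positivity)
  have hsq : ‖x‖ ^ 2 + ε = √(‖x‖ ^ 2 + ε) ^ 2 := (sq_sqrt (by positivity)).symm
  have second (i : Fin 2) :
      fderiv ℝ (fun y => fderiv ℝ (fun y : ℝ² => exp (-c * √(‖y‖ ^ 2 + ε))) y
        (EuclideanSpace.single i 1)) x (EuclideanSpace.single i 1) =
      (c ^ 2 * (x i ^ 2 / √(‖x‖ ^ 2 + ε) ^ 2) -
        c * (√(‖x‖ ^ 2 + ε))⁻¹ * (1 - x i ^ 2 / √(‖x‖ ^ 2 + ε) ^ 2)) *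
        exp (-c * √(‖x‖ ^ 2 + ε)) := by
    simp only [fderiv_exp_neg_mul_sqrt_single hε]
    have hr := hasFDerivAt_sqrt_norm_sq_add hε x
    have hinv := (hasDerivAt_inv hs.ne').comp_hasFDerivAt x hr
    have hproj := (EuclideanSpace.proj i : ℝ² →L[ℝ] ℝ).hasFDerivAt (x := x)
    have h := (hproj.mul (hinv.mul (hr.const_mul (-c)).exp)).const_mul (-c)
    have h' := congrArg (fun L : ℝ² →L[ℝ] ℝ => L (EuclideanSpace.single i 1)) h.fderiv
    refine Eq.trans (by rfl) (h'.trans ?_)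
    simp [EuclideanSpace.inner_single_right]
    field_simp
    ring
  have hnorm : ‖x‖ ^ 2 = x 0 ^ 2 + x 1 ^ 2 := by
    simp [EuclideanSpace.norm_sq_eq]
  rw [lap, Fin.sum_univ_two, second, second]
  rw [show ‖x‖ ^ 2 / (‖x‖ ^ 2 + ε) = (x 0 ^ 2 + x 1 ^ 2) / √(‖x‖ ^ 2 + ε) ^ 2 by
    rw [← hsq, hnorm]]
  ring

end RegularizedExponential

section RadialIntegrals

lemma integrable_inv_norm_mul_exp_neg_norm :
    Integrable (fun x : ℝ² => ‖x‖⁻¹ * exp (-‖x‖)) := by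
  rw [integrable_fun_norm_addHaar volume (f := fun r : ℝ => r⁻¹ * exp (-r))]
  refine (integrableOn_exp_neg_Ioi 0).congr_fun (fun y hy => ?_) measurableSet_Ioi
  have : y ≠ 0 := ne_of_gt hy
  simp [this]

lemma integral_inv_norm_mul_exp_neg_norm :
    ∫ x : ℝ², ‖x‖⁻¹ * exp (-‖x‖) = 2 * π := by
  rw [integral_fun_norm_addHaar volume (fun r : ℝ => r⁻¹ * exp (-r)),
    setIntegral_congr_fun (g := fun y => exp (-y)) measurableSet_Ioi (fun y hy => ?_),
    integral_exp_neg_Ioi_zero]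
  · simp [Measure.real, pi_nonneg]
  · have : y ≠ 0 := ne_of_gt hy
    simp [this]

lemma integrable_exp_neg_norm : Integrable (fun x : ℝ² => exp (-‖x‖)) := by
  rw [integrable_fun_norm_addHaar volume (f := fun r : ℝ => exp (-r))]
  refine (GammaIntegral_convergent (s := 2) (by norm_num)).congr_fun (fun y _ => ?_)
    measurableSet_Ioi
  norm_num
  ring

lemma integral_exp_neg_mul_norm {c : ℝ} (hc : 0 < c) :
    ∫ x : ℝ², exp (-‖x‖ * c) = (c ^ 2)⁻¹ * ∫ x : ℝ², exp (-‖x‖) := by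
  have h := Measure.integral_comp_smul (volume : Measure ℝ²) (fun x => exp (-‖x‖)) c
  simp only [norm_smul, norm_eq_abs, abs_of_pos hc, finrank_euclideanSpace_fin, smul_eq_mul] at h
  rw [abs_of_nonneg (by positivity)] at h
  rw [← h]
  congr! 3
  ring

lemma integrable_exp_neg_mul_norm {c : ℝ} (hc : 0 < c) :
    Integrable (fun x : ℝ² => exp (-‖x‖ * c)) := by
  have h := integrable_exp_neg_norm.comp_smul hc.ne'
  simp only [norm_smul, norm_eq_abs, abs_of_pos hc] at h
  convert h using 3
  ring

lemma integrable_inv_norm_mul {ψ : ℝ² → ℝ} (hψ : Continuous ψ) (hsupp : HasCompactSupport ψ) :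
    Integrable (fun x => ‖x‖⁻¹ * ψ x) := by
  have hcont : Continuous (fun x => exp ‖x‖ * ψ x) := by fun_prop
  obtain ⟨C, hC⟩ := hcont.bounded_above_of_compact_support hsupp.mul_left
  convert integrable_inv_norm_mul_exp_neg_norm.mul_bdd (c := C) hcont.aestronglyMeasurable
    (.of_forall hC) using 2 with x
  rw [exp_neg]
  field_simp

end RadialIntegrals

lemma ae_norm_pos : ∀ᵐ x : ℝ², 0 < ‖x‖ := by
  filter_upwards [Measure.ae_ne volume (0 : ℝ²)] with x hx using norm_pos_iff.2 hx

open Filter Topology in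
/-- The distributional Laplacian of `exp (-c|x|)` in the plane. -/
lemma integral_exp_neg_mul_norm_mul_lap {φ : ℝ² → ℝ} {c : ℝ} (hc : 0 ≤ c) (hφ : ContDiff ℝ 2 φ)
    (hsupp : HasCompactSupport φ) (hlap : Continuous (lap φ)) (hlap' : HasCompactSupport (lap φ)) :
    ∫ x, exp (-‖x‖ * c) * lap φ x = ∫ x, (c ^ 2 - c * ‖x‖⁻¹) * exp (-‖x‖ * c) * φ x := by
  have hlim (x : ℝ²) : Tendsto (fun ε : ℝ => √(‖x‖ ^ 2 + ε)) (𝓝[>] 0) (𝓝 ‖x‖) := by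
    have : ContinuousAt (fun ε : ℝ => √(‖x‖ ^ 2 + ε)) 0 := by fun_prop
    simpa [ContinuousAt] using this.tendsto.mono_left nhdsWithin_le_nhds
  have hexp_le (x : ℝ²) (ε : ℝ) : exp (-c * √(‖x‖ ^ 2 + ε)) ≤ 1 :=
    exp_le_one_iff.2 (by nlinarith [sqrt_nonneg (‖x‖ ^ 2 + ε)])
  have hleft : Tendsto (fun ε : ℝ => ∫ x : ℝ², exp (-c * √(‖x‖ ^ 2 + ε)) * lap φ x) (𝓝[>] 0)
      (𝓝 (∫ x, exp (-‖x‖ * c) * lap φ x)) := by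
    refine tendsto_integral_filter_of_dominated_convergence (fun x => ‖lap φ x‖)
      (.of_forall fun ε => ?_) (.of_forall fun ε => .of_forall fun x => ?_)
      (hlap.integrable_of_hasCompactSupport hlap').norm (.of_forall fun x => ?_)
    · exact (by fun_prop : Continuous _).aestronglyMeasurable
    · rw [norm_mul, norm_of_nonneg (exp_nonneg _)]
      exact mul_le_of_le_one_left (norm_nonneg _) (hexp_le x ε)
    · rw [show -‖x‖ * c = -c * ‖x‖ by ring]
      exact (((hlim x).const_mul (-c)).rexp).mul_const _
  have hright : Tendsto (fun ε : ℝ => ∫ x : ℝ², exp (-c * √(‖x‖ ^ 2 + ε)) * lap φ x) (𝓝[>] 0)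
      (𝓝 (∫ x, (c ^ 2 - c * ‖x‖⁻¹) * exp (-‖x‖ * c) * φ x)) := by
    have heq : ∀ᶠ ε : ℝ in 𝓝[>] 0,
        ∫ x : ℝ², (c ^ 2 * (‖x‖ ^ 2 / (‖x‖ ^ 2 + ε)) -
          c * (√(‖x‖ ^ 2 + ε))⁻¹ * (2 - ‖x‖ ^ 2 / (‖x‖ ^ 2 + ε))) *
          exp (-c * √(‖x‖ ^ 2 + ε)) * φ x = ∫ x : ℝ², exp (-c * √(‖x‖ ^ 2 + ε)) * lap φ x := by
      filter_upwards [self_mem_nhdsWithin] with ε hε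
      rw [integral_mul_lap_eq_integral_lap_mul (contDiff_exp_neg_mul_sqrt hε c) hφ hsupp]
      simp_rw [lap_exp_neg_mul_sqrt hε]
    refine Tendsto.congr' heq ?_
    have hφc := hφ.continuous
    refine tendsto_integral_filter_of_dominated_convergence
      (fun x => c ^ 2 * ‖φ x‖ + 2 * c * (‖x‖⁻¹ * ‖φ x‖)) ?_ ?_ ?_ ?_
    · refine .of_forall fun ε => Measurable.aestronglyMeasurable ?_
      fun_prop
    · filter_upwards [self_mem_nhdsWithin] with ε (hε : 0 < ε)
      filter_upwards [ae_norm_pos] with x hx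
      have hq0 : 0 ≤ ‖x‖ ^ 2 / (‖x‖ ^ 2 + ε) := by positivity
      have hq1 : ‖x‖ ^ 2 / (‖x‖ ^ 2 + ε) ≤ 1 := (div_le_one (by positivity)).2 (by linarith)
      have hs : (√(‖x‖ ^ 2 + ε))⁻¹ ≤ ‖x‖⁻¹ :=
        inv_anti₀ hx (le_sqrt_of_sq_le (by linarith))
      have hs0 : 0 ≤ (√(‖x‖ ^ 2 + ε))⁻¹ := by positivity
      generalize ‖x‖ ^ 2 / (‖x‖ ^ 2 + ε) = q at *
      have h1 : c ^ 2 * q ≤ c ^ 2 := mul_le_of_le_one_right (by positivity) hq1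
      have h2 : c * (√(‖x‖ ^ 2 + ε))⁻¹ * (2 - q) ≤ c * ‖x‖⁻¹ * 2 := by gcongr <;> linarith
      have h3 : 0 ≤ c * (√(‖x‖ ^ 2 + ε))⁻¹ * (2 - q) := mul_nonneg (by positivity) (by linarith)
      have h4 : 0 ≤ c ^ 2 * q := by positivity
      have h5 : 0 ≤ c * ‖x‖⁻¹ * 2 := by positivity
      rw [norm_mul, norm_mul, norm_of_nonneg (exp_nonneg _)]
      calc _ ≤ (c ^ 2 + c * ‖x‖⁻¹ * 2) * 1 * ‖φ x‖ := by
            gcongr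
            · rw [norm_eq_abs, abs_le]
              constructor <;> nlinarith
            · exact hexp_le x ε
        _ = _ := by ring
    · exact ((hφc.norm.integrable_of_hasCompactSupport hsupp.norm).const_mul _).add
        ((integrable_inv_norm_mul hφc.norm hsupp.norm).const_mul _)
    · filter_upwards [ae_norm_pos] with x hx
      have hq : Tendsto (fun ε : ℝ => ‖x‖ ^ 2 / (‖x‖ ^ 2 + ε)) (𝓝[>] 0) (𝓝 1) := by
        have : ContinuousAt (fun ε : ℝ => ‖x‖ ^ 2 / (‖x‖ ^ 2 + ε)) 0 := by
          refine ContinuousAt.div₀ (by fun_prop) (by fun_prop) ?_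
          positivity
        have h := this.tendsto.mono_left (nhdsWithin_le_nhds (s := Set.Ioi 0))
        simpa [hx.ne'] using h
      have h := ((((hq.const_mul (c ^ 2)).sub ((((hlim x).inv₀ hx.ne').const_mul c).mul
        (hq.const_sub 2))).mul ((hlim x).const_mul (-c)).rexp).mul_const (φ x))
      convert h using 2
      ring_nf
  exact tendsto_nhds_unique hleft hright

section Primitive

lemma hasDerivAt_integral_sinh {φ : ℝ² → ℝ} (hφ : Continuous φ) (hsupp : HasCompactSupport φ)
    (t : ℝ) :
    HasDerivAt (fun s => ∫ x, sinh s * ‖x‖⁻¹ * exp (-‖x‖ * cosh s) * φ x)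
      (∫ x, (cosh t * ‖x‖⁻¹ - sinh t ^ 2) * exp (-‖x‖ * cosh t) * φ x) t := by
  have hint : Integrable φ := hφ.integrable_of_hasCompactSupport hsupp
  have hint' := integrable_inv_norm_mul hφ hsupp
  have hexp_le (s : ℝ) (x : ℝ²) : exp (-‖x‖ * cosh s) ≤ 1 :=
    exp_le_one_iff.2 (by nlinarith [norm_nonneg x, cosh_pos s])
  refine (hasDerivAt_integral_of_dominated_loc_of_deriv_le
    (F := fun s x => sinh s * ‖x‖⁻¹ * exp (-‖x‖ * cosh s) * φ x)
    (F' := fun s x => (cosh s * ‖x‖⁻¹ - sinh s ^ 2) * exp (-‖x‖ * cosh s) * φ x)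
    (bound := fun x => cosh (|t| + 1) * (‖x‖⁻¹ * ‖φ x‖) + cosh (|t| + 1) ^ 2 * ‖φ x‖)
    (Metric.ball_mem_nhds t one_pos) (.of_forall fun s => ?_) ?_ ?_ ?_ ?_ ?_).2
  · exact Measurable.aestronglyMeasurable (by fun_prop)
  · have hexp : AEStronglyMeasurable (fun x : ℝ² => exp (-‖x‖ * cosh t)) :=
      Continuous.aestronglyMeasurable (by fun_prop)
    have h := (hint'.bdd_mul (c := 1) hexp (.of_forall fun x => by
      rw [norm_of_nonneg (exp_nonneg _)]
      exact hexp_le t x)).const_mul (sinh t)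
    refine h.congr (.of_forall fun x => ?_)
    ring
  · exact Measurable.aestronglyMeasurable (by fun_prop)
  · refine .of_forall fun x s hs => ?_
    have hs' : cosh s ≤ cosh (|t| + 1) := by
      rw [cosh_le_cosh]
      rw [Metric.mem_ball, Real.dist_eq] at hs
      rw [abs_of_nonneg (by positivity : 0 ≤ |t| + 1)]
      linarith [abs_sub_abs_le_abs_sub s t]
    have hpos := cosh_pos s
    have hsinh : sinh s ^ 2 ≤ cosh (|t| + 1) ^ 2 := by
      rw [sinh_sq]
      nlinarith
    rw [norm_mul, norm_mul, norm_of_nonneg (exp_nonneg _)]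
    calc _ ≤ (cosh (|t| + 1) * ‖x‖⁻¹ + cosh (|t| + 1) ^ 2) * 1 * ‖φ x‖ := by
          gcongr
          · refine (norm_sub_le _ _).trans ?_
            rw [norm_of_nonneg (by positivity), norm_of_nonneg (by positivity)]
            gcongr
          · exact hexp_le s x
      _ = _ := by ring
  · exact ((integrable_inv_norm_mul hφ.norm hsupp.norm).const_mul _).add (hint.norm.const_mul _)
  · filter_upwards [ae_norm_pos] with x hx s _
    have h := ((((hasDerivAt_sinh s).mul_const ‖x‖⁻¹).mul
      ((hasDerivAt_cosh s).const_mul (-‖x‖)).exp).mul_const (φ x))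
    refine h.congr_deriv ?_
    field_simp
    ring

open Filter Topology in
lemma tendsto_integral_sinh {φ : ℝ² → ℝ} (hφ : Continuous φ) (hsupp : HasCompactSupport φ) :
    Tendsto (fun t => ∫ x, sinh t * ‖x‖⁻¹ * exp (-‖x‖ * cosh t) * φ x) atTop
      (𝓝 (2 * π * φ 0)) := by
  have hscale (t : ℝ) : ∫ x, sinh t * ‖x‖⁻¹ * exp (-‖x‖ * cosh t) * φ x =
      tanh t * ∫ x, ‖x‖⁻¹ * exp (-‖x‖) * φ ((cosh t)⁻¹ • x) := by
    have hc := cosh_pos t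
    have h := Measure.integral_comp_smul (volume : Measure ℝ²)
      (fun x => ‖x‖⁻¹ * exp (-‖x‖) * φ ((cosh t)⁻¹ • x)) (cosh t)
    simp only [norm_smul, norm_eq_abs, abs_of_pos hc, finrank_euclideanSpace_fin, smul_eq_mul,
      smul_smul, inv_mul_cancel₀ hc.ne', one_smul] at h
    rw [abs_of_nonneg (by positivity), ← div_eq_inv_mul, eq_div_iff (by positivity)] at h
    rw [← h, ← integral_mul_const, ← integral_const_mul]
    refine integral_congr_ae (.of_forall fun x => ?_)
    simp only [tanh_eq_sinh_div_cosh, mul_inv]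
    rw [show -(cosh t * ‖x‖) = -‖x‖ * cosh t by ring]
    field_simp
  have hcosh : Tendsto (fun t => (cosh t)⁻¹) atTop (𝓝 0) := by
    refine (tendsto_atTop_mono (fun t => ?_)
      (tendsto_exp_atTop.atTop_div_const two_pos)).inv_tendsto_atTop
    rw [cosh_eq]
    linarith [exp_pos (-t)]
  have htanh : Tendsto tanh atTop (𝓝 1) := by
    have h : tanh = fun t => 1 - exp (-t) * (cosh t)⁻¹ := by
      ext t
      rw [← cosh_sub_sinh, tanh_eq_sinh_div_cosh]
      field_simp [(cosh_pos t).ne']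
      ring
    rw [h]
    simpa using (tendsto_exp_neg_atTop_nhds_zero.mul hcosh).const_sub 1
  obtain ⟨C, hC⟩ := hφ.bounded_above_of_compact_support hsupp
  have hlim : Tendsto (fun t => ∫ x, ‖x‖⁻¹ * exp (-‖x‖) * φ ((cosh t)⁻¹ • x)) atTop
      (𝓝 (∫ x : ℝ², ‖x‖⁻¹ * exp (-‖x‖) * φ 0)) := by
    refine tendsto_integral_filter_of_dominated_convergence
      (fun x => ‖x‖⁻¹ * exp (-‖x‖) * C) (.of_forall fun t => ?_)
      (.of_forall fun t => .of_forall fun x => ?_)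
      (integrable_inv_norm_mul_exp_neg_norm.mul_const C) (.of_forall fun x => ?_)
    · exact Measurable.aestronglyMeasurable (by fun_prop)
    · rw [norm_mul, norm_of_nonneg (by positivity)]
      gcongr
      exact hC _
    · have h : Tendsto (fun t => (cosh t)⁻¹ • x) atTop (𝓝 0) := by
        simpa using hcosh.smul_const x
      exact ((hφ.tendsto 0).comp h).const_mul _
  rw [integral_mul_const, integral_inv_norm_mul_exp_neg_norm] at hlim
  simpa only [hscale, one_mul] using htanh.mul hlim

end Primitive

lemma integrable_inv_cosh_sq : IntegrableOn (fun t : ℝ => (cosh t ^ 2)⁻¹) (Set.Ioi 0) := by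
  refine ((integrableOn_exp_mul_Ioi (a := -2) (by norm_num) 0).const_mul 4).mono'
    (by fun_prop : Measurable _).aestronglyMeasurable (.of_forall fun t => ?_)
  rw [norm_of_nonneg (by positivity)]
  have h : exp t / 2 ≤ cosh t := by
    rw [cosh_eq]
    linarith [exp_pos (-t)]
  calc (cosh t ^ 2)⁻¹ ≤ ((exp t / 2) ^ 2)⁻¹ := by gcongr
    _ = 4 * exp (-2 * t) := by
      rw [show -2 * t = -t + -t by ring, exp_add, exp_neg]
      field_simp
      norm_num

lemma integrable_exp_neg_norm_mul_cosh_mul {ψ : ℝ² → ℝ} (hψ : Continuous ψ)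
    (hsupp : HasCompactSupport ψ) :
    Integrable (Function.uncurry fun (x : ℝ²) (t : ℝ) => exp (-‖x‖ * cosh t) * ψ x)
      (volume.prod (volume.restrict (Set.Ioi 0))) := by
  obtain ⟨C, hC⟩ := hψ.bounded_above_of_compact_support hsupp
  have hmeas : Continuous
      (Function.uncurry fun (x : ℝ²) (t : ℝ) => exp (-‖x‖ * cosh t) * ψ x) := by
    unfold Function.uncurry
    fun_prop
  have hslice (t : ℝ) : Integrable (fun x : ℝ² => exp (-‖x‖ * cosh t) * ψ x) :=
    (by fun_prop : Continuous _).integrable_of_hasCompactSupport hsupp.mul_left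
  refine (integrable_prod_iff' hmeas.aestronglyMeasurable).2
    ⟨.of_forall hslice, ?_⟩
  refine (integrable_inv_cosh_sq.mul_const ((∫ x : ℝ², exp (-‖x‖)) * C)).mono'
    ?_ (.of_forall fun t => ?_)
  · exact hmeas.aestronglyMeasurable.norm.prod_swap.integral_prod_right'
  · rw [norm_of_nonneg (integral_nonneg fun x => norm_nonneg _), ← mul_assoc,
      ← integral_exp_neg_mul_norm (cosh_pos t), ← integral_mul_const]
    refine integral_mono (hslice t).norm
      ((integrable_exp_neg_mul_norm (cosh_pos t)).mul_const C) fun x => ?_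
    simp only [Function.uncurry, norm_mul, norm_of_nonneg (exp_nonneg _)]
    gcongr
    exact hC x

/-- `−(1/(2π)) K₀(|x|)` is a fundamental solution of `Δ − 1` in two dimensions:
for every smooth compactly supported `φ`, `−(1/(2π)) ∫ K₀(|x|) (Δφ(x) − φ(x)) dx = φ(0)`. -/
theorem K0_fundamental_solution
    (φ : EuclideanSpace ℝ (Fin 2) → ℝ) (hφ : ContDiff ℝ (⊤ : ℕ∞) φ) (hsupp : HasCompactSupport φ) :
    -(1 / (2 * Real.pi)) * ∫ x : EuclideanSpace ℝ (Fin 2), K0 ‖x‖ * (lap φ x - φ x) = φ 0 := by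
  have hφ2 : ContDiff ℝ 2 φ := hφ.of_le (by norm_cast)
  have hφc := hφ.continuous
  have hlap : Continuous (lap φ) := continuous_finsetSum _ fun i _ =>
    ((((hφ2.fderiv_right (m := 1) (by norm_num)).clm_apply contDiff_const).continuous_fderiv
      (by norm_num)).clm_apply continuous_const)
  have hlap' : HasCompactSupport (lap φ) := by
    have h (i : Fin 2) :=
      (hsupp.fderiv_apply ℝ (EuclideanSpace.single i 1)).fderiv_apply ℝ (EuclideanSpace.single i 1)
    have hsum : lap φ = _ := funext fun x => Fin.sum_univ_two _
    rw [hsum]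
    exact (h 0).add (h 1)
  have hψ : Continuous (fun x => lap φ x - φ x) := hlap.sub hφc
  have hψ' : HasCompactSupport (fun x => lap φ x - φ x) := hlap'.sub hsupp
  have hint := integrable_exp_neg_norm_mul_cosh_mul hψ hψ'
  have hinner (t : ℝ) : ∫ x, exp (-‖x‖ * cosh t) * (lap φ x - φ x) =
      -∫ x, (cosh t * ‖x‖⁻¹ - sinh t ^ 2) * exp (-‖x‖ * cosh t) * φ x := by
    have hexp : Continuous (fun x : ℝ² => exp (-‖x‖ * cosh t)) := by fun_prop
    have hi : Integrable (fun x => exp (-‖x‖ * cosh t) * φ x) :=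
      (hexp.mul hφc).integrable_of_hasCompactSupport hsupp.mul_left
    have hi_lap : Integrable (fun x => exp (-‖x‖ * cosh t) * lap φ x) :=
      (hexp.mul hlap).integrable_of_hasCompactSupport hlap'.mul_left
    have hi' : Integrable (fun x => (cosh t ^ 2 - cosh t * ‖x‖⁻¹) * exp (-‖x‖ * cosh t) * φ x) := by
      convert (hi.const_mul (cosh t ^ 2)).sub
        ((integrable_inv_norm_mul (hexp.mul hφc) hsupp.mul_left).const_mul (cosh t)) using 2
      simp only [Pi.mul_apply, Pi.sub_apply]
      ring
    simp only [mul_sub]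
    rw [integral_sub hi_lap hi,
      integral_exp_neg_mul_norm_mul_lap (cosh_pos t).le hφ2 hsupp hlap hlap',
      ← integral_sub hi' hi, ← integral_neg]
    refine integral_congr_ae (.of_forall fun x => ?_)
    simp only [sinh_sq]
    ring
  have hmain : ∫ x : ℝ², K0 ‖x‖ * (lap φ x - φ x) = -(2 * π * φ 0) := by
    simp only [K0, ← integral_mul_const]
    rw [integral_integral_swap hint]
    have hF := hint.integral_prod_right
    simp only [Function.uncurry, hinner] at hF
    simp only [hinner]
    rw [integral_neg, integral_Ioi_of_hasDerivAt_of_tendsto'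
      (fun t _ => hasDerivAt_integral_sinh hφc hsupp t) (integrable_neg_iff.1 hF)
      (tendsto_integral_sinh hφc hsupp)]
    simp
  rw [hmain]
  field_simp
end
end

section
/- Define K₀(x) = ∫₀^∞ exp(−x cosh t) dt for x > 0, fix a ∈ ℝ², and define f : ℝ² \ {a} → ℝ by f(x) = log|x − a| + K₀(|x − a|). Then f is twice differentiable on ℝ² \ {a} and satisfies Δf(x) = K₀(|x − a|) for every x ≠ a. -/
noncomputable section

open Real MeasureTheory

open Filter Topology

/-- The integrals `∫₀^∞ coshⁿ t · exp(−x cosh t) dt`, which are up to sign the derivatives of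
`K0`. -/
def coshMoment (n : ℕ) (x : ℝ) : ℝ :=
  ∫ t in Set.Ioi (0 : ℝ), Real.cosh t ^ n * Real.exp (-x * Real.cosh t)

theorem coshMoment_zero : coshMoment 0 = K0 := by
  funext x
  simp [coshMoment, K0]

theorem one_add_sq_le_cosh_sq (t : ℝ) : 1 + t ^ 2 ≤ Real.cosh t ^ 2 := by
  have h : t ^ 2 ≤ Real.sinh t ^ 2 := by
    rw [sq_le_sq, Real.abs_sinh]
    exact Real.self_le_sinh_iff.2 (abs_nonneg t)
  rw [Real.cosh_sq]
  linarith

theorem cosh_pow_mul_exp_le (n : ℕ) {x : ℝ} (hx : 0 < x) (t : ℝ) :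
    Real.cosh t ^ n * Real.exp (-x * Real.cosh t) ≤
      ((n + 2).factorial / x ^ (n + 2)) * (1 + t ^ 2)⁻¹ := by
  have hc := Real.cosh_pos t
  have h := Real.pow_div_factorial_le_exp (x * Real.cosh t) (by positivity) (n + 2)
  have hf : (0 : ℝ) < (n + 2).factorial := by positivity
  rw [div_le_iff₀ hf, mul_pow] at h
  have hE := Real.exp_pos (x * Real.cosh t)
  rw [neg_mul, Real.exp_neg, ← div_eq_mul_inv, ← div_eq_mul_inv, div_div,
    div_le_div_iff₀ hE (by positivity)]
  calc Real.cosh t ^ n * (x ^ (n + 2) * (1 + t ^ 2))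
      ≤ Real.cosh t ^ n * (x ^ (n + 2) * Real.cosh t ^ 2) := by
        gcongr
        exact one_add_sq_le_cosh_sq t
    _ = x ^ (n + 2) * Real.cosh t ^ (n + 2) := by ring
    _ ≤ _ := by linarith

theorem integrable_cosh_pow_mul_exp (n : ℕ) {x : ℝ} (hx : 0 < x) :
    Integrable fun t => Real.cosh t ^ n * Real.exp (-x * Real.cosh t) := by
  refine (integrable_inv_one_add_sq.const_mul ((n + 2).factorial / x ^ (n + 2))).mono'
    (by fun_prop) (ae_of_all _ fun t => ?_)
  have hc := Real.cosh_pos t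
  rw [Real.norm_of_nonneg (by positivity)]
  exact cosh_pow_mul_exp_le n hx t

theorem hasDerivAt_coshMoment (n : ℕ) {x : ℝ} (hx : 0 < x) :
    HasDerivAt (coshMoment n) (-coshMoment (n + 1) x) x := by
  have h := (hasDerivAt_integral_of_dominated_loc_of_deriv_le
    (μ := volume.restrict (Set.Ioi (0 : ℝ))) (s := Set.Ioi (x / 2)) (x₀ := x)
    (F := fun y t => Real.cosh t ^ n * Real.exp (-y * Real.cosh t))
    (F' := fun y t => -(Real.cosh t ^ (n + 1) * Real.exp (-y * Real.cosh t)))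
    (bound := fun t => Real.cosh t ^ (n + 1) * Real.exp (-(x / 2) * Real.cosh t))
    (Ioi_mem_nhds (by linarith)) (Eventually.of_forall fun y => by fun_prop)
    (integrable_cosh_pow_mul_exp n hx).restrict (by fun_prop)
    (ae_of_all _ fun t y hy => ?_)
    (integrable_cosh_pow_mul_exp (n + 1) (half_pos hx)).restrict
    (ae_of_all _ fun t y _ => ?_)).2
  · rwa [integral_neg] at h
  · have hc := Real.cosh_pos t
    rw [norm_neg, Real.norm_of_nonneg (by positivity)]
    gcongr
    exact le_of_lt hy
  · have h := ((((hasDerivAt_id y).neg.mul_const (Real.cosh t)).exp).const_mul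
      (Real.cosh t ^ n))
    refine h.congr_deriv ?_
    simp only [id, Pi.neg_apply]
    ring

/-- The modified Bessel equation of order zero. -/
theorem bessel_ode_coshMoment {x : ℝ} (hx : 0 < x) :
    x * coshMoment 2 x - coshMoment 1 x = x * coshMoment 0 x := by
  have h0 := (integrable_cosh_pow_mul_exp 0 hx).integrableOn (s := Set.Ioi 0)
  have h1 := (integrable_cosh_pow_mul_exp 1 hx).integrableOn (s := Set.Ioi 0)
  have h2 := (integrable_cosh_pow_mul_exp 2 hx).integrableOn (s := Set.Ioi 0)
  let v : ℝ → ℝ := fun t => Real.sinh t * Real.exp (-x * Real.cosh t)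
  let v' : ℝ → ℝ := fun t =>
    Real.cosh t ^ 1 * Real.exp (-x * Real.cosh t)
      - (x * (Real.cosh t ^ 2 * Real.exp (-x * Real.cosh t))
        - x * (Real.cosh t ^ 0 * Real.exp (-x * Real.cosh t)))
  have hv : ∀ t, HasDerivAt v (v' t) t := fun t => by
    have h := (Real.hasDerivAt_sinh t).mul (((Real.hasDerivAt_cosh t).const_mul (-x)).exp)
    refine h.congr_deriv ?_
    simp only [v']
    linear_combination -x * Real.exp (-x * Real.cosh t) * Real.sinh_sq t
  have hv' : IntegrableOn v' (Set.Ioi 0) := h1.sub ((h2.const_mul x).sub (h0.const_mul x))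
  have hvi : IntegrableOn v (Set.Ioi 0) := by
    refine Integrable.mono' h1 (by fun_prop) (ae_of_all _ fun t => ?_)
    rw [norm_mul, Real.norm_eq_abs, Real.norm_eq_abs, Real.abs_exp, pow_one, Real.abs_sinh]
    gcongr
    exact (Real.sinh_lt_cosh _).le.trans_eq (Real.cosh_abs t)
  have hlim := tendsto_zero_of_hasDerivAt_of_integrableOn_Ioi (fun t _ => hv t) hv' hvi
  have key := integral_Ioi_of_hasDerivAt_of_tendsto' (fun t _ => hv t) hv' hlim
  have hsplit : ∫ t in Set.Ioi 0, v' t =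
      coshMoment 1 x - (x * coshMoment 2 x - x * coshMoment 0 x) := by
    simp only [v', coshMoment]
    rw [integral_sub h1 (by exact (h2.const_mul x).sub (h0.const_mul x)),
      integral_sub (h2.const_mul x) (h0.const_mul x), integral_const_mul, integral_const_mul]
  rw [hsplit] at key
  simp only [v, Real.sinh_zero, zero_mul, sub_zero] at key
  linarith

theorem hasFDerivAt_norm_sub {E : Type*} [NormedAddCommGroup E] [InnerProductSpace ℝ E]
    {a y : E} (hy : y ≠ a) :
    HasFDerivAt (fun z => ‖z - a‖) (‖y - a‖⁻¹ • innerSL ℝ (y - a)) y := by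
  have hr : 0 < ‖y - a‖ := norm_pos_iff.2 (sub_ne_zero.2 hy)
  have h := (((hasFDerivAt_id y).sub_const a).norm_sq).sqrt (by simpa using hr.ne')
  convert h using 1
  · funext z
    simp
  · ext z
    simp
    field_simp

section Radial

variable {ι : Type*} [Fintype ι] {a y : EuclideanSpace ℝ ι}

theorem HasDerivAt.hasFDerivAt_comp_norm_sub {g : ℝ → ℝ} {g' : ℝ} (hy : y ≠ a)
    (hg : HasDerivAt g g' ‖y - a‖) :
    HasFDerivAt (fun z => g ‖z - a‖) (g' • (‖y - a‖⁻¹ • innerSL ℝ (y - a))) y :=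
  hg.comp_hasFDerivAt y (hasFDerivAt_norm_sub hy)

theorem fderiv_radial_single [DecidableEq ι] {f : EuclideanSpace ℝ ι → ℝ} {g : ℝ → ℝ} {g' : ℝ}
    (hf : ∀ x, x ≠ a → f x = g ‖x - a‖) (hy : y ≠ a) (hg : HasDerivAt g g' ‖y - a‖) (i : ι) :
    DifferentiableAt ℝ f y ∧
      fderiv ℝ f y (EuclideanSpace.single i 1) = g' / ‖y - a‖ * (y i - a i) := by
  have h : HasFDerivAt f (g' • (‖y - a‖⁻¹ • innerSL ℝ (y - a))) y :=
    (hg.hasFDerivAt_comp_norm_sub hy).congr_of_eventuallyEq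
      ((eventually_ne_nhds hy).mono hf)
  refine ⟨h.differentiableAt, ?_⟩
  rw [h.fderiv]
  simp [EuclideanSpace.inner_single_right]
  ring

theorem hasFDerivAt_radial_mul_coord [DecidableEq ι] {φ : ℝ → ℝ} {φ' : ℝ} (hy : y ≠ a)
    (hφ : HasDerivAt φ φ' ‖y - a‖) (i : ι) :
    ∃ L : EuclideanSpace ℝ ι →L[ℝ] ℝ, HasFDerivAt (fun z => φ ‖z - a‖ * (z i - a i)) L y ∧
      L (EuclideanSpace.single i 1) = φ ‖y - a‖ + φ' / ‖y - a‖ * (y i - a i) ^ 2 := by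
  have hc : HasFDerivAt (fun z : EuclideanSpace ℝ ι => z i - a i)
      (EuclideanSpace.proj i : EuclideanSpace ℝ ι →L[ℝ] ℝ) y :=
    (EuclideanSpace.proj i : EuclideanSpace ℝ ι →L[ℝ] ℝ).hasFDerivAt.sub_const (a i)
  refine ⟨_, (hφ.hasFDerivAt_comp_norm_sub hy).mul hc, ?_⟩
  simp [EuclideanSpace.inner_single_right]
  ring

end Radial

/-- The function `f(x) = log|x − a| + K₀(|x − a|)` is twice differentiable away from `a`
and satisfies `Δf(x) = K₀(|x − a|)` for every `x ≠ a`. -/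
theorem laplacian_log_add_K0
    (a : EuclideanSpace ℝ (Fin 2)) (f : EuclideanSpace ℝ (Fin 2) → ℝ)
    (hf : ∀ x, x ≠ a → f x = Real.log ‖x - a‖ + K0 ‖x - a‖) :
    ∀ x, x ≠ a →
      (DifferentiableAt ℝ f x ∧
        ∀ i : Fin 2,
          DifferentiableAt ℝ (fun y => fderiv ℝ f y (EuclideanSpace.single i 1)) x) ∧
      lap f x = K0 ‖x - a‖ := by
  simp only [← coshMoment_zero] at hf ⊢
  set φ : ℝ → ℝ := fun r => (r⁻¹ - coshMoment 1 r) / r with hφdef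
  have hpos : ∀ y, y ≠ a → 0 < ‖y - a‖ := fun y hy => norm_pos_iff.2 (sub_ne_zero.2 hy)
  have hg : ∀ r : ℝ, 0 < r → HasDerivAt (fun r => Real.log r + coshMoment 0 r)
      (r⁻¹ - coshMoment 1 r) r := fun r hr =>
    (Real.hasDerivAt_log hr.ne').add (hasDerivAt_coshMoment 0 hr)
  have hφ : ∀ r : ℝ, 0 < r → HasDerivAt φ
      (((-(r ^ 2)⁻¹ - -coshMoment 2 r) * r - (r⁻¹ - coshMoment 1 r) * 1) / r ^ 2) r :=
    fun r hr =>
      ((hasDerivAt_inv hr.ne').sub (hasDerivAt_coshMoment 1 hr)).div (hasDerivAt_id r) hr.ne'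
  intro x hx
  have hgrad : ∀ i : Fin 2, (fun y => fderiv ℝ f y (EuclideanSpace.single i 1)) =ᶠ[𝓝 x]
      fun y => φ ‖y - a‖ * (y i - a i) := fun i =>
    (eventually_ne_nhds hx).mono fun y hy =>
      (fderiv_radial_single hf hy (hg _ (hpos y hy)) i).2
  choose L hL hLi using hasFDerivAt_radial_mul_coord (ι := Fin 2) hx (hφ _ (hpos x hx))
  have hL' := fun i => (hL i).congr_of_eventuallyEq (hgrad i)
  refine ⟨⟨(fderiv_radial_single hf hx (hg _ (hpos x hx)) 0).1,
    fun i => (hL' i).differentiableAt⟩, ?_⟩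
  have hr := hpos x hx
  have hode := bessel_ode_coshMoment hr
  have hn := EuclideanSpace.real_norm_sq_eq (x - a)
  simp only [Fin.sum_univ_two, PiLp.sub_apply] at hn
  simp only [lap, Fin.sum_univ_two, (hL' _).fderiv, hLi, hφdef]
  generalize ‖x - a‖ = r at *
  have h1 : (x 1 - a 1) ^ 2 = r ^ 2 - (x 0 - a 0) ^ 2 := by linarith
  rw [h1]
  field_simp
  linear_combination r ^ 3 * hode
end
end

section
/- Define K₀(x) = ∫₀^∞ exp(−x cosh t) dt and K₁(x) = ∫₀^∞ exp(−x cosh t) cosh t dt for x > 0, fix a ∈ ℝ², and define f : ℝ² \ {a} → ℝ by f(x) = log|x − a| + K₀(|x − a|). Then for every x ≠ a the gradient of f is ∇f(x) = ((x − a)/|x − a|) · ( 1/|x − a| − K₁(|x − a|) ), and ∇f(x) tends to 0 as x tends to a. -/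
noncomputable section

open Real MeasureTheory Filter Topology

/-- `t ↦ exp (-s sinh t) cosh t` is the derivative of `t ↦ -s⁻¹ exp (-s sinh t)`. -/
theorem hasDerivAt_neg_inv_mul_exp_neg_mul_sinh {s : ℝ} (hs : s ≠ 0) (t : ℝ) :
    HasDerivAt (fun t => -s⁻¹ * exp (-s * sinh t)) (exp (-s * sinh t) * cosh t) t := by
  refine ((((hasDerivAt_sinh t).const_mul (-s)).exp).const_mul (-s⁻¹)).congr_deriv ?_
  field_simp

theorem tendsto_neg_inv_mul_exp_neg_mul_sinh {s : ℝ} (hs : 0 < s) :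
    Tendsto (fun t => -s⁻¹ * exp (-s * sinh t)) atTop (𝓝 0) := by
  have h : Tendsto sinh atTop atTop := by
    refine tendsto_atTop_mono' _ ?_ tendsto_id
    filter_upwards [eventually_ge_atTop 0] with t ht using self_le_sinh_iff.2 ht
  have h' := (tendsto_exp_atBot.comp (h.const_mul_atTop_of_neg (neg_lt_zero.2 hs))).const_mul (-s⁻¹)
  simpa using h'

theorem integrableOn_exp_neg_mul_sinh_mul_cosh_s11 {s : ℝ} (hs : 0 < s) :
    IntegrableOn (fun t => exp (-s * sinh t) * cosh t) (Set.Ioi 0) :=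
  integrableOn_Ioi_deriv_of_nonneg'
    (fun t _ => hasDerivAt_neg_inv_mul_exp_neg_mul_sinh hs.ne' t)
    (fun t _ => mul_nonneg (exp_pos _).le (cosh_pos t).le)
    (tendsto_neg_inv_mul_exp_neg_mul_sinh hs)

theorem integral_exp_neg_mul_sinh_mul_cosh_s11 {s : ℝ} (hs : 0 < s) :
    ∫ t in Set.Ioi (0 : ℝ), exp (-s * sinh t) * cosh t = s⁻¹ := by
  rw [integral_Ioi_of_hasDerivAt_of_nonneg'
    (fun t _ => hasDerivAt_neg_inv_mul_exp_neg_mul_sinh hs.ne' t)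
    (fun t _ => mul_nonneg (exp_pos _).le (cosh_pos t).le)
    (tendsto_neg_inv_mul_exp_neg_mul_sinh hs)]
  simp

theorem exp_neg_mul_cosh_le_exp_neg_mul_sinh_s11 {s : ℝ} (hs : 0 ≤ s) (t : ℝ) :
    exp (-s * cosh t) ≤ exp (-s * sinh t) := by
  rw [exp_le_exp]
  nlinarith [sinh_lt_cosh t]

theorem integrableOn_exp_neg_mul_cosh_mul_cosh_s11 {s : ℝ} (hs : 0 < s) :
    IntegrableOn (fun t => exp (-s * cosh t) * cosh t) (Set.Ioi 0) := by
  refine (integrableOn_exp_neg_mul_sinh_mul_cosh_s11 hs).mono'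
    (Continuous.aestronglyMeasurable (by fun_prop)) (ae_of_all _ fun t => ?_)
  rw [norm_of_nonneg (mul_nonneg (exp_pos _).le (cosh_pos t).le)]
  exact mul_le_mul_of_nonneg_right (exp_neg_mul_cosh_le_exp_neg_mul_sinh_s11 hs.le t) (cosh_pos t).le

theorem integrableOn_exp_neg_mul_cosh_s11 {s : ℝ} (hs : 0 < s) :
    IntegrableOn (fun t => exp (-s * cosh t)) (Set.Ioi 0) := by
  refine (integrableOn_exp_neg_mul_cosh_mul_cosh_s11 hs).mono'
    (Continuous.aestronglyMeasurable (by fun_prop)) (ae_of_all _ fun t => ?_)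
  rw [norm_of_nonneg (exp_pos _).le]
  exact le_mul_of_one_le_right (exp_pos _).le (one_le_cosh t)

theorem hasDerivAt_K0 {r : ℝ} (hr : 0 < r) : HasDerivAt K0 (-K1 r) r := by
  have h := (hasDerivAt_integral_of_dominated_loc_of_deriv_le
    (μ := volume.restrict (Set.Ioi (0 : ℝ))) (F := fun x t => exp (-x * cosh t))
    (F' := fun x t => -(exp (-x * cosh t) * cosh t)) (x₀ := r) (s := Set.Ioi (r / 2))
    (bound := fun t => exp (-(r / 2) * cosh t) * cosh t)
    (Ioi_mem_nhds (half_lt_self hr))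
    (Eventually.of_forall fun x => Continuous.aestronglyMeasurable (by fun_prop))
    (integrableOn_exp_neg_mul_cosh_s11 hr) (Continuous.aestronglyMeasurable (by fun_prop))
    (ae_of_all _ fun t x hx => ?_) (integrableOn_exp_neg_mul_cosh_mul_cosh_s11 (half_pos hr))
    (ae_of_all _ fun t x _ => ?_)).2
  · rwa [integral_neg] at h
  · rw [norm_neg, norm_of_nonneg (mul_nonneg (exp_pos _).le (cosh_pos t).le)]
    refine mul_le_mul_of_nonneg_right (exp_le_exp.2 ?_) (cosh_pos t).le
    nlinarith [cosh_pos t, Set.mem_Ioi.1 hx]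
  · refine (((hasDerivAt_neg x).mul_const (cosh t)).exp).congr_deriv ?_
    ring

theorem sq_div_four_le_sinh {t : ℝ} (ht : 0 ≤ t) : t ^ 2 / 4 ≤ sinh t := by
  have h₁ := quadratic_le_exp_of_nonneg ht
  have h₂ : exp (-t) ≤ 1 := exp_le_one_iff.2 (by linarith)
  rw [sinh_eq]
  linarith

theorem K1_le_inv {r : ℝ} (hr : 0 < r) : K1 r ≤ r⁻¹ := by
  rw [← integral_exp_neg_mul_sinh_mul_cosh_s11 hr]
  exact integral_mono (integrableOn_exp_neg_mul_cosh_mul_cosh_s11 hr)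
    (integrableOn_exp_neg_mul_sinh_mul_cosh_s11 hr) fun t =>
      mul_le_mul_of_nonneg_right (exp_neg_mul_cosh_le_exp_neg_mul_sinh_s11 hr.le t) (cosh_pos t).le

/-- The pointwise form of the bound `r⁻¹ - K₁(r) ≤ r ∫₀^∞ exp (-r t² / 4) dt`. -/
theorem exp_sinh_sub_exp_cosh_mul_cosh_le {r t : ℝ} (hr : 0 ≤ r) (ht : 0 ≤ t) :
    exp (-r * sinh t) * cosh t - exp (-r * cosh t) * cosh t ≤ r * exp (-(r / 4) * t ^ 2) := by
  have h₁ : exp (-r * cosh t) = exp (-r * sinh t) * exp (-(r * exp (-t))) := by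
    rw [← exp_add, ← cosh_sub_sinh]
    ring_nf
  have h₂ : 1 - exp (-(r * exp (-t))) ≤ r * exp (-t) := by
    linarith [add_one_le_exp (-(r * exp (-t)))]
  have h₃ : exp (-t) * cosh t ≤ 1 := by
    have h : exp (-t) ≤ 1 := exp_le_one_iff.2 (by linarith)
    have h' : exp (-t) * exp t = 1 := by rw [← exp_add]; simp
    rw [cosh_eq]
    nlinarith [exp_pos (-t)]
  have h₄ : exp (-r * sinh t) ≤ exp (-(r / 4) * t ^ 2) :=
    exp_le_exp.2 (by nlinarith [sq_div_four_le_sinh ht])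
  calc exp (-r * sinh t) * cosh t - exp (-r * cosh t) * cosh t
      = exp (-r * sinh t) * ((1 - exp (-(r * exp (-t)))) * cosh t) := by rw [h₁]; ring
    _ ≤ exp (-r * sinh t) * (r * exp (-t) * cosh t) := by
        have := cosh_pos t
        gcongr
    _ = r * exp (-r * sinh t) * (exp (-t) * cosh t) := by ring
    _ ≤ r * exp (-r * sinh t) * 1 := by gcongr
    _ ≤ r * exp (-(r / 4) * t ^ 2) := by rw [mul_one]; gcongr

theorem inv_sub_K1_le {r : ℝ} (hr : 0 < r) : r⁻¹ - K1 r ≤ √(π * r) := by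
  have hr₄ : 0 < r / 4 := by positivity
  calc r⁻¹ - K1 r
      = ∫ t in Set.Ioi (0 : ℝ), (exp (-r * sinh t) * cosh t - exp (-r * cosh t) * cosh t) := by
        rw [integral_sub (integrableOn_exp_neg_mul_sinh_mul_cosh_s11 hr)
          (integrableOn_exp_neg_mul_cosh_mul_cosh_s11 hr), integral_exp_neg_mul_sinh_mul_cosh_s11 hr, K1]
    _ ≤ ∫ t in Set.Ioi (0 : ℝ), r * exp (-(r / 4) * t ^ 2) :=
        setIntegral_mono_on ((integrableOn_exp_neg_mul_sinh_mul_cosh_s11 hr).sub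
            (integrableOn_exp_neg_mul_cosh_mul_cosh_s11 hr))
          ((integrable_exp_neg_mul_sq hr₄).integrableOn.const_mul r) measurableSet_Ioi
          fun t ht => exp_sinh_sub_exp_cosh_mul_cosh_le hr.le (Set.mem_Ioi.1 ht).le
    _ = r * (√(π / (r / 4)) / 2) := by rw [integral_const_mul, integral_gaussian_Ioi]
    _ = √(π * r) := by
        have h : π / (r / 4) = (2 / r) ^ 2 * (π * r) := by field_simp; norm_num
        rw [h, sqrt_mul (sq_nonneg _), sqrt_sq (by positivity)]
        field_simp

theorem HasDerivAt.hasGradientAt_norm_sub {E : Type*} [NormedAddCommGroup E]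
    [InnerProductSpace ℝ E] [CompleteSpace E] {g : ℝ → ℝ} {g' : ℝ} {a x : E} (hx : x ≠ a)
    (hg : HasDerivAt g g' ‖x - a‖) :
    HasGradientAt (fun y => g ‖y - a‖) ((‖x - a‖⁻¹ * g') • (x - a)) x := by
  have hpos : 0 < ‖x - a‖ := norm_pos_iff.2 (sub_ne_zero.2 hx)
  have h := (((hasFDerivAt_id x).sub_const a).norm_sq).sqrt (by simpa using hpos.ne')
  simp only [id, sqrt_sq (norm_nonneg _)] at h
  rw [hasGradientAt_iff_hasFDerivAt]
  refine (hg.comp_hasFDerivAt x h).congr_fderiv ?_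
  ext v
  simp
  field_simp

/-- The gradient of `f(x) = log|x − a| + K₀(|x − a|)` is
`∇f(x) = ((x − a)/|x − a|) (1/|x − a| − K₁(|x − a|))` for `x ≠ a`, and `∇f(x) → 0` as `x → a`. -/
theorem gradient_log_add_K0
    (a : EuclideanSpace ℝ (Fin 2)) (f : EuclideanSpace ℝ (Fin 2) → ℝ)
    (hf : ∀ x, x ≠ a → f x = Real.log ‖x - a‖ + K0 ‖x - a‖) :
    (∀ x, x ≠ a →
      gradient f x = (‖x - a‖⁻¹ * (‖x - a‖⁻¹ - K1 ‖x - a‖)) • (x - a)) ∧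
    Tendsto (fun x => gradient f x) (𝓝[≠] a) (𝓝 0) := by
  have hgrad : ∀ x, x ≠ a →
      gradient f x = (‖x - a‖⁻¹ * (‖x - a‖⁻¹ - K1 ‖x - a‖)) • (x - a) := fun x hx => by
    have hpos : 0 < ‖x - a‖ := norm_pos_iff.2 (sub_ne_zero.2 hx)
    have hg : HasDerivAt (fun r => log r + K0 r) (‖x - a‖⁻¹ - K1 ‖x - a‖) ‖x - a‖ :=
      (hasDerivAt_log hpos.ne').add (hasDerivAt_K0 hpos)
    refine ((hg.hasGradientAt_norm_sub hx).congr_of_eventuallyEq ?_).gradient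
    filter_upwards [isOpen_ne.mem_nhds hx] with y hy using hf y hy
  refine ⟨hgrad, squeeze_zero_norm' (a := fun x => √(π * ‖x - a‖)) ?_ ?_⟩
  · filter_upwards [self_mem_nhdsWithin] with x hx
    have hpos : 0 < ‖x - a‖ := norm_pos_iff.2 (sub_ne_zero.2 hx)
    have hnonneg := sub_nonneg.2 (K1_le_inv hpos)
    rw [hgrad x hx, norm_smul, norm_of_nonneg (by positivity), mul_right_comm,
      inv_mul_cancel₀ hpos.ne', one_mul]
    exact inv_sub_K1_le hpos
  · have h : Continuous fun x => √(π * ‖x - a‖) := by fun_prop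
    simpa using (h.tendsto a).mono_left nhdsWithin_le_nhds
end
end

section
/- For each natural number n, define Iₙ(x) = (1/π) ∫₀^π exp(x cos θ) cos(nθ) dθ. Then Iₙ(r) > 0 for every r > 0; in particular Iₙ(r) ≠ 0 for every r > 0. -/
noncomputable section

open Real MeasureTheory intervalIntegral

/-- The modified Bessel function of the first kind of order `n`,
`Iₙ(x) = (1/π) ∫₀^π exp(x cos θ) cos(nθ) dθ`. -/
def besselI (n : ℕ) (x : ℝ) : ℝ :=
  (1 / Real.pi) * ∫ θ in (0 : ℝ)..Real.pi, Real.exp (x * Real.cos θ) * Real.cos (n * θ)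

theorem integral_cos_int_mul (m : ℤ) (hm : m ≠ 0) :
    ∫ θ in (0 : ℝ)..π, cos (m * θ) = 0 := by
  have hm' : (m : ℝ) ≠ 0 := by exact_mod_cast hm
  simp [intervalIntegral.integral_comp_mul_left (fun x => cos x) hm', sin_int_mul_pi]

theorem integral_cos_pow_succ_mul_cos_int_mul (k : ℕ) (m : ℤ) :
    ∫ θ in (0 : ℝ)..π, cos θ ^ (k + 1) * cos (m * θ) =
      ((∫ θ in (0 : ℝ)..π, cos θ ^ k * cos ((m + 1 : ℤ) * θ)) +
        ∫ θ in (0 : ℝ)..π, cos θ ^ k * cos ((m - 1 : ℤ) * θ)) / 2 := by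
  rw [← intervalIntegral.integral_add (Continuous.intervalIntegrable (by fun_prop) _ _)
    (Continuous.intervalIntegrable (by fun_prop) _ _), ← intervalIntegral.integral_div]
  refine intervalIntegral.integral_congr fun θ _ => ?_
  simp only [Int.cast_add, Int.cast_sub, Int.cast_one, add_mul, sub_mul, one_mul, cos_add, cos_sub]
  ring

theorem integral_cos_pow_mul_cos_int_mul_nonneg (k : ℕ) (m : ℤ) :
    0 ≤ ∫ θ in (0 : ℝ)..π, cos θ ^ k * cos (m * θ) := by
  induction k generalizing m with
  | zero =>
    rcases eq_or_ne m 0 with rfl | hm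
    · simp [pi_pos.le]
    · simp [integral_cos_int_mul m hm]
  | succ k ih =>
    rw [integral_cos_pow_succ_mul_cos_int_mul]
    linarith [ih (m + 1), ih (m - 1)]

theorem integral_cos_pow_mul_cos_nat_mul_pos (n : ℕ) :
    0 < ∫ θ in (0 : ℝ)..π, cos θ ^ n * cos ((n : ℤ) * θ) := by
  induction n with
  | zero => simp [pi_pos]
  | succ n ih =>
    rw [integral_cos_pow_succ_mul_cos_int_mul]
    have h := integral_cos_pow_mul_cos_int_mul_nonneg n ((n + 1 : ℕ) + 1)
    have e : ((n + 1 : ℕ) : ℤ) - 1 = n := by simp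
    rw [e]
    linarith

theorem hasSum_integral_exp_mul_cos_mul_cos (r : ℝ) (m : ℤ) :
    HasSum (fun k : ℕ => r ^ k / k.factorial * ∫ θ in (0 : ℝ)..π, cos θ ^ k * cos (m * θ))
      (∫ θ in (0 : ℝ)..π, exp (r * cos θ) * cos (m * θ)) := by
  simp_rw [← intervalIntegral.integral_const_mul]
  refine intervalIntegral.hasSum_integral_of_dominated_convergence
    (fun k _ => |r| ^ k / k.factorial) (fun k => ?_) (fun k => ?_) ?_ ?_ ?_
  · exact Continuous.aestronglyMeasurable (by fun_prop)
  · refine .of_forall fun θ _ => ?_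
    rw [norm_mul, norm_mul, norm_div, norm_pow, norm_pow, Real.norm_natCast]
    simp only [Real.norm_eq_abs]
    refine mul_le_of_le_one_right (by positivity) (mul_le_one₀ ?_ (abs_nonneg _) ?_)
    · exact pow_le_one₀ (abs_nonneg _) (abs_cos_le_one θ)
    · exact abs_cos_le_one _
  · exact .of_forall fun θ _ => Real.summable_pow_div_factorial |r|
  · exact intervalIntegrable_const
  · refine .of_forall fun θ _ => ?_
    have h : HasSum (fun k : ℕ => (r * cos θ) ^ k / k.factorial) (exp (r * cos θ)) := by
      rw [Real.exp_eq_exp_ℝ]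
      exact NormedSpace.expSeries_div_hasSum_exp _
    refine (h.mul_right (cos (m * θ))).congr_fun fun k => ?_
    ring

/-- `Iₙ(r) > 0` for every `r > 0`; in particular `Iₙ(r) ≠ 0` for every `r > 0`. -/
theorem besselI_pos (n : ℕ) : ∀ r > (0 : ℝ), 0 < besselI n r := by
  intro r hr
  have h := hasSum_integral_exp_mul_cos_mul_cos r n
  refine mul_pos (by positivity) ?_
  have hpos := h.summable.tsum_pos
    (fun k => mul_nonneg (by positivity) (integral_cos_pow_mul_cos_int_mul_nonneg k n)) n
    (mul_pos (by positivity) (integral_cos_pow_mul_cos_nat_mul_pos n))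
  rw [h.tsum_eq] at hpos
  exact_mod_cast hpos
end
end

section
/- For each natural number n, define Iₙ(x) = (1/π) ∫₀^π exp(x cos θ) cos(nθ) dθ, fix x₀ ∈ ℝ², and for k ∈ ℤ define q_k : ℝ² → ℂ by q_k(x) = I_{|k|}(|x − x₀|) · exp(i k θ(x)) for x ≠ x₀ (where θ(x) is the polar angle of x − x₀) and q_k(x₀) = I_{|k|}(0). Let Ω ⊆ ℝ² be a bounded open set with x₀ ∈ Ω, let m be a natural number, and let (α_k)_{|k| ≤ m} be complex numbers such that Σ_{|k| ≤ m} α_k q_k(x) = 0 for every x in the boundary of Ω. Then α_k = 0 for every k with |k| ≤ m. In other words, the boundary restrictions {q_k|_{∂Ω} : |k| ≤ m} are linearly independent. -/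
noncomputable section

open Real MeasureTheory Complex Classical

/-- The integral `∫₀^π cosʲ θ cos(nθ) dθ`, the coefficient of `xʲ / j!` in `π Iₙ(x)`. -/
def cosMoment (j : ℕ) (n : ℤ) : ℝ :=
  ∫ θ in (0 : ℝ)..Real.pi, Real.cos θ ^ j * Real.cos (n * θ)

theorem cosMoment_zero_zero : cosMoment 0 0 = Real.pi := by
  simp [cosMoment]

theorem cosMoment_zero_of_ne {n : ℤ} (hn : n ≠ 0) : cosMoment 0 n = 0 := by
  have hn' : (n : ℝ) ≠ 0 := by exact_mod_cast hn
  simp [cosMoment, intervalIntegral.integral_comp_mul_left (fun t => Real.cos t) hn',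
    Real.sin_int_mul_pi]

theorem cosMoment_succ (j : ℕ) (n : ℤ) :
    cosMoment (j + 1) n = (cosMoment j (n + 1) + cosMoment j (n - 1)) / 2 := by
  unfold cosMoment
  rw [← intervalIntegral.integral_add (Continuous.intervalIntegrable (by fun_prop) _ _)
    (Continuous.intervalIntegrable (by fun_prop) _ _), ← intervalIntegral.integral_div]
  refine intervalIntegral.integral_congr fun θ _ => ?_
  push_cast
  simp only [add_mul, sub_mul, one_mul, Real.cos_add, Real.cos_sub]
  ring

theorem cosMoment_nonneg (j : ℕ) (n : ℤ) : 0 ≤ cosMoment j n := by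
  induction j generalizing n with
  | zero =>
    by_cases hn : n = 0
    · rw [hn, cosMoment_zero_zero]; exact Real.pi_nonneg
    · exact (cosMoment_zero_of_ne hn).ge
  | succ j ih =>
    rw [cosMoment_succ]
    linarith [ih (n + 1), ih (n - 1)]

theorem cosMoment_self_pos (n : ℕ) : 0 < cosMoment n n := by
  induction n with
  | zero => simpa [cosMoment_zero_zero] using Real.pi_pos
  | succ n ih =>
    rw [cosMoment_succ]
    have h := cosMoment_nonneg n ((n + 1 : ℕ) + 1)
    have e : ((n + 1 : ℕ) : ℤ) - 1 = n := by push_cast; ring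
    rw [e]
    linarith

theorem hasSum_cosMoment (n : ℕ) (x : ℝ) :
    HasSum (fun j : ℕ => x ^ j / j.factorial * cosMoment j n) (Real.pi * besselI n x) := by
  have e : Real.pi * besselI n x =
      ∫ θ in (0 : ℝ)..Real.pi, Real.exp (x * Real.cos θ) * Real.cos (n * θ) := by
    rw [besselI, ← mul_assoc, mul_one_div_cancel Real.pi_ne_zero, one_mul]
  have h := intervalIntegral.hasSum_integral_of_dominated_convergence (μ := volume)
    (a := 0) (b := Real.pi)
    (F := fun (j : ℕ) θ => (x * Real.cos θ) ^ j / j.factorial * Real.cos (n * θ))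
    (f := fun θ => Real.exp (x * Real.cos θ) * Real.cos (n * θ))
    (fun j _ => |x| ^ j / j.factorial)
    (fun j => (by fun_prop : Continuous _).aestronglyMeasurable)
    (fun j => .of_forall fun θ _ => by
      rw [norm_mul, norm_div, norm_pow, norm_mul, Real.norm_natCast]
      simp only [Real.norm_eq_abs]
      have h1 := Real.abs_cos_le_one θ
      have h2 := Real.abs_cos_le_one (n * θ)
      calc (|x| * |Real.cos θ|) ^ j / j.factorial * |Real.cos (n * θ)|
          ≤ (|x| * 1) ^ j / j.factorial * 1 := by gcongr
        _ = _ := by ring)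
    (.of_forall fun θ _ => Real.summable_pow_div_factorial _)
    intervalIntegrable_const
    (.of_forall fun θ _ => by
      have := NormedSpace.expSeries_div_hasSum_exp (x * Real.cos θ)
      rw [← Real.exp_eq_exp_ℝ] at this
      exact this.mul_right _)
  rw [e]
  convert! h using 2 with j
  rw [cosMoment, ← intervalIntegral.integral_const_mul]
  refine intervalIntegral.integral_congr fun θ _ => ?_
  push_cast
  ring

theorem besselI_pos_s18 (n : ℕ) {x : ℝ} (hx : 0 < x) : 0 < besselI n x := by
  have h := sum_le_hasSum {n} (fun j _ => by have := cosMoment_nonneg j n; positivity)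
    (hasSum_cosMoment n x)
  rw [Finset.sum_singleton] at h
  have := cosMoment_self_pos n
  exact pos_of_mul_pos_right (lt_of_lt_of_le (by positivity) h) Real.pi_nonneg

theorem one_lt_besselI_zero {x : ℝ} (hx : 0 < x) : 1 < besselI 0 x := by
  have h := sum_le_hasSum {0, 2} (fun j _ => by have := cosMoment_nonneg j (0 : ℕ); positivity)
    (hasSum_cosMoment 0 x)
  have h2 : 0 < cosMoment 2 0 := by
    rw [cosMoment_succ]
    have := cosMoment_self_pos 1
    have := cosMoment_nonneg 1 (0 - 1)
    simp at *
    linarith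
  simp [cosMoment_zero_zero] at h
  refine lt_of_mul_lt_mul_left ?_ Real.pi_nonneg
  have : 0 < x ^ 2 / 2 * cosMoment 2 0 := by positivity
  linarith

theorem integral_exp_mul_cexp (k : ℤ) (r θ : ℝ) :
    ∫ φ in (0 : ℝ)..2 * Real.pi,
      Complex.exp ((r * Real.cos θ * Real.cos φ + r * Real.sin θ * Real.sin φ : ℝ) : ℂ) *
        Complex.exp (Complex.I * k * φ) =
      2 * Real.pi * besselI k.natAbs r * Complex.exp (Complex.I * k * θ) := by
  have hcos (φ : ℝ) : Real.cos (k.natAbs * φ) = Real.cos (k * φ) := by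
    rcases Int.natAbs_eq k with h | h <;> nth_rewrite 2 [h] <;> simp
  let g : ℝ → ℂ := fun φ => Complex.exp ((r * Real.cos φ : ℝ) : ℂ) * Complex.exp (Complex.I * k * φ)
  have hg : Continuous g := by fun_prop
  have hper : Function.Periodic g (2 * Real.pi) := fun φ => by
    simp only [g, Real.cos_add_two_pi]
    congr 1
    rw [Complex.exp_eq_exp_iff_exists_int]
    exact ⟨k, by push_cast; ring⟩
  have h1 (φ : ℝ) :
      Complex.exp ((r * Real.cos θ * Real.cos φ + r * Real.sin θ * Real.sin φ : ℝ) : ℂ) *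
        Complex.exp (Complex.I * k * φ) = g (φ - θ) * Complex.exp (Complex.I * k * θ) := by
    simp only [g]
    rw [← Complex.exp_add, ← Complex.exp_add, ← Complex.exp_add, Real.cos_sub]
    congr 1
    push_cast
    ring
  simp only [h1]
  rw [intervalIntegral.integral_mul_const, intervalIntegral.integral_comp_sub_right]
  congr 1
  have h2 := hper.intervalIntegral_add_eq (0 - θ) (-Real.pi)
  rw [show 0 - θ + 2 * Real.pi = 2 * Real.pi - θ by ring,
    show -Real.pi + 2 * Real.pi = Real.pi by ring] at h2
  rw [h2, ← intervalIntegral.integral_add_adjacent_intervals (b := 0)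
    (hg.intervalIntegrable _ _) (hg.intervalIntegrable _ _)]
  have h3 := intervalIntegral.integral_comp_neg (a := 0) (b := Real.pi) g
  rw [neg_zero] at h3
  rw [← h3, ← intervalIntegral.integral_add
    (Continuous.intervalIntegrable (by fun_prop) _ _) (hg.intervalIntegrable _ _)]
  have h4 (φ : ℝ) : g (-φ) + g φ =
      ((2 * (Real.exp (r * Real.cos φ) * Real.cos (k.natAbs * φ)) : ℝ) : ℂ) := by
    simp only [g, Real.cos_neg, hcos, ← mul_add]
    push_cast
    rw [mul_left_comm, Complex.two_cos, add_comm]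
    ring_nf
  simp only [h4]
  rw [intervalIntegral.integral_ofReal, intervalIntegral.integral_const_mul, besselI]
  have := Real.pi_ne_zero
  push_cast
  field_simp

theorem integral_cexp_int_mul (n : ℤ) :
    ∫ t in (0 : ℝ)..2 * Real.pi, Complex.exp (Complex.I * n * t) =
      if n = 0 then 2 * (Real.pi : ℂ) else 0 := by
  split_ifs with h
  · simp [h]
  · rw [integral_exp_mul_complex (by simp [h])]
    have : Complex.exp (Complex.I * n * (2 * Real.pi : ℝ)) = 1 :=
      Complex.exp_eq_one_iff.2 ⟨n, by push_cast; ring⟩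
    rw [this]
    simp

theorem eq_zero_of_forall_sum_cexp_eq_zero (s : Finset ℤ) (c : ℤ → ℂ)
    (h : ∀ t : ℝ, ∑ k ∈ s, c k * Complex.exp (Complex.I * k * t) = 0) {k : ℤ} (hk : k ∈ s) :
    c k = 0 := by
  have e (t : ℝ) : ∑ j ∈ s, c j * Complex.exp (Complex.I * (j - k : ℤ) * t) = 0 := by
    have := congrArg (· * Complex.exp (-(Complex.I * k * t))) (h t)
    simp only [Finset.sum_mul, zero_mul, mul_assoc, ← Complex.exp_add] at this
    rw [← this]
    refine Finset.sum_congr rfl fun j _ => ?_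
    congr 2
    push_cast
    ring
  have h0 : ∫ t in (0 : ℝ)..2 * Real.pi,
      ∑ j ∈ s, c j * Complex.exp (Complex.I * (j - k : ℤ) * t) = 0 := by
    simp [-Int.cast_sub, e]
  rw [intervalIntegral.integral_finsetSum
    fun j _ => Continuous.intervalIntegrable (by fun_prop) _ _] at h0
  simp only [intervalIntegral.integral_const_mul, integral_cexp_int_mul, sub_eq_zero] at h0
  simpa [hk] using h0

/-- The Laplace-type transform `(a, b) ↦ ∫₀^{2π} exp(a cos φ + b sin φ) P(φ) dφ`. -/
def planeWaveIntegral (P : ℝ → ℂ) (a b : ℝ) : ℂ :=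
  ∫ φ in (0 : ℝ)..2 * Real.pi,
    Complex.exp ((a * Real.cos φ + b * Real.sin φ : ℝ) : ℂ) * P φ

theorem continuous_planeWaveIntegral {P : ℝ → ℂ} (hP : Continuous P) :
    Continuous fun z : ℝ × ℝ => planeWaveIntegral P z.1 z.2 := by
  unfold planeWaveIntegral
  exact intervalIntegral.continuous_parametric_intervalIntegral_of_continuous' (by fun_prop) _ _

theorem planeWaveIntegral_trigPolynomial (s : Finset ℤ) (c : ℤ → ℂ) (r t : ℝ) :
    planeWaveIntegral (fun φ => ∑ k ∈ s, c k * Complex.exp (Complex.I * k * φ))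
      (r * Real.cos t) (r * Real.sin t) =
      2 * Real.pi * ∑ k ∈ s, c k * (besselI k.natAbs r * Complex.exp (Complex.I * k * t)) := by
  unfold planeWaveIntegral
  simp only [Finset.mul_sum]
  rw [intervalIntegral.integral_finsetSum
    fun j _ => Continuous.intervalIntegrable (by fun_prop) _ _]
  refine Finset.sum_congr rfl fun k _ => ?_
  simp only [mul_left_comm _ (c k)]
  rw [intervalIntegral.integral_const_mul, integral_exp_mul_cexp, mul_assoc]

theorem circleMean_planeWaveIntegral {P : ℝ → ℂ} (hP : Continuous P) (a b r : ℝ) :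
    ∫ t in (0 : ℝ)..2 * Real.pi, planeWaveIntegral P (a + r * Real.cos t) (b + r * Real.sin t) =
      2 * Real.pi * besselI 0 r * planeWaveIntegral P a b := by
  have hpi : (0 : ℝ) ≤ 2 * Real.pi := by positivity
  have hmean (φ : ℝ) :
      ∫ t in (0 : ℝ)..2 * Real.pi, Complex.exp (((a + r * Real.cos t) * Real.cos φ +
        (b + r * Real.sin t) * Real.sin φ : ℝ) : ℂ) * P φ =
      2 * Real.pi * besselI 0 r *
        (Complex.exp ((a * Real.cos φ + b * Real.sin φ : ℝ) : ℂ) * P φ) := by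
    have h := integral_exp_mul_cexp 0 r φ
    simp only [Int.cast_zero, mul_zero, zero_mul, Complex.exp_zero, mul_one, Int.natAbs_zero] at h
    rw [← h, ← intervalIntegral.integral_mul_const]
    refine intervalIntegral.integral_congr fun t _ => ?_
    rw [← mul_assoc, ← Complex.exp_add]
    congr 2
    push_cast
    ring
  unfold planeWaveIntegral
  rw [← intervalIntegral.integral_const_mul]
  simp only [← hmean]
  simp only [intervalIntegral.integral_of_le hpi]
  refine MeasureTheory.integral_integral_swap ?_
  rw [Measure.prod_restrict]
  refine IntegrableOn.mono_set (t := Set.Icc 0 (2 * Real.pi) ×ˢ Set.Icc 0 (2 * Real.pi)) ?_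
    (Set.prod_mono Set.Ioc_subset_Icc_self Set.Ioc_subset_Icc_self)
  refine ContinuousOn.integrableOn_compact (isCompact_Icc.prod isCompact_Icc) ?_
  exact (by unfold Function.uncurry; fun_prop : Continuous _).continuousOn

/-- The point at distance `r` from `p` in direction `t`. -/
def polarPoint (p : EuclideanSpace ℝ (Fin 2)) (r t : ℝ) : EuclideanSpace ℝ (Fin 2) :=
  p + !₂[r * Real.cos t, r * Real.sin t]

theorem polarPoint_mem_closedBall (p : EuclideanSpace ℝ (Fin 2)) {r : ℝ} (hr : 0 ≤ r) (t : ℝ) :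
    polarPoint p r t ∈ Metric.closedBall p r := by
  rw [Metric.mem_closedBall, dist_eq_norm, polarPoint, add_sub_cancel_left,
    EuclideanSpace.norm_eq, Real.sqrt_le_left hr]
  simp only [Fin.sum_univ_two, Real.norm_eq_abs, sq_abs]
  simp only [Matrix.cons_val_zero, Matrix.cons_val_one]
  nlinarith [Real.sin_sq_add_cos_sq t]

/-- A bounded-domain maximum principle for `planeWaveIntegral`, based on the mean value
identity `circleMean_planeWaveIntegral` and `I₀ > 1`. -/
theorem planeWaveIntegral_eq_zero_of_frontier {P : ℝ → ℂ} (hP : Continuous P)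
    {x₀ : EuclideanSpace ℝ (Fin 2)} {Ω : Set (EuclideanSpace ℝ (Fin 2))} (hΩo : IsOpen Ω)
    (hΩb : Bornology.IsBounded Ω)
    (h : ∀ x ∈ frontier Ω, planeWaveIntegral P ((x - x₀) 0) ((x - x₀) 1) = 0) :
    ∀ x ∈ Ω, planeWaveIntegral P ((x - x₀) 0) ((x - x₀) 1) = 0 := by
  intro x hx
  set V : EuclideanSpace ℝ (Fin 2) → ℂ :=
    fun x => planeWaveIntegral P ((x - x₀) 0) ((x - x₀) 1) with hV
  have hVc : Continuous V := (continuous_planeWaveIntegral hP).comp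
    (by fun_prop : Continuous fun x : EuclideanSpace ℝ (Fin 2) => ((x - x₀) 0, (x - x₀) 1))
  obtain ⟨p, hp, hmax⟩ := hΩb.isCompact_closure.exists_isMaxOn ⟨x, subset_closure hx⟩
    hVc.norm.continuousOn
  suffices hVp : V p = 0 by
    have h : ‖V x‖ ≤ ‖V p‖ := hmax (subset_closure hx)
    rw [hVp, norm_zero] at h
    exact norm_le_zero_iff.1 h
  by_cases hpΩ : p ∈ Ω
  swap
  · exact h p (by rw [hΩo.frontier_eq]; exact ⟨hp, hpΩ⟩)
  obtain ⟨r, hr, hball⟩ := Metric.nhds_basis_closedBall.mem_iff.1 (hΩo.mem_nhds hpΩ)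
  have hle (t : ℝ) : ‖planeWaveIntegral P ((p - x₀) 0 + r * Real.cos t)
      ((p - x₀) 1 + r * Real.sin t)‖ ≤ ‖V p‖ := by
    have hmem := hball (polarPoint_mem_closedBall p hr.le t)
    have hmem_le : ‖V (polarPoint p r t)‖ ≤ ‖V p‖ := hmax (subset_closure hmem)
    simp only [hV, polarPoint, add_sub_right_comm p, PiLp.add_apply,
      Matrix.cons_val_zero, Matrix.cons_val_one] at hmem_le
    exact hmem_le
  have hnorm := intervalIntegral.norm_integral_le_of_norm_le_const (a := 0) (b := 2 * Real.pi)
    fun t _ => hle t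
  rw [circleMean_planeWaveIntegral hP] at hnorm
  have hI := one_lt_besselI_zero hr
  rw [norm_mul, norm_mul, norm_mul, Complex.norm_real, Complex.norm_real, Complex.norm_ofNat,
    Real.norm_of_nonneg Real.pi_nonneg, Real.norm_of_nonneg (by linarith), sub_zero,
    abs_of_pos (by positivity)] at hnorm
  change 2 * Real.pi * besselI 0 r * ‖V p‖ ≤ _ at hnorm
  have h1 : 2 * Real.pi * ((besselI 0 r - 1) * ‖V p‖) ≤ 0 := by linarith
  have h2 : (besselI 0 r - 1) * ‖V p‖ ≤ 0 := by
    by_contra! h3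
    have := mul_pos (mul_pos two_pos Real.pi_pos) h3
    linarith
  by_contra hne
  have := mul_pos (sub_pos.2 hI) (norm_pos_iff.2 hne)
  linarith

/-- **Linear independence of the boundary restrictions of the family `{Q_k}`**:
if a finite linear combination `Σ_{|k| ≤ m} α_k q_k`, with
`q_k(x) = I_{|k|}(|x − x₀|) e^{i k θ(x)}`, vanishes on the boundary of a bounded open set
`Ω ∋ x₀`, then all coefficients vanish. -/
theorem qk_boundary_linear_independence
    (x₀ : EuclideanSpace ℝ (Fin 2))
    (θ : EuclideanSpace ℝ (Fin 2) → ℝ)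
    (hθ : ∀ x, x ≠ x₀ → θ x ∈ Set.Ico (0 : ℝ) (2 * Real.pi) ∧
      (x - x₀) 0 = ‖x - x₀‖ * Real.cos (θ x) ∧ (x - x₀) 1 = ‖x - x₀‖ * Real.sin (θ x))
    (q : ℤ → EuclideanSpace ℝ (Fin 2) → ℂ)
    (hq : ∀ (k : ℤ) (x : EuclideanSpace ℝ (Fin 2)),
      q k x = if x = x₀ then (besselI k.natAbs 0 : ℂ)
        else (besselI k.natAbs ‖x - x₀‖ : ℂ) * Complex.exp (Complex.I * (k : ℂ) * (θ x : ℂ)))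
    (Ω : Set (EuclideanSpace ℝ (Fin 2))) (hΩo : IsOpen Ω) (hΩb : Bornology.IsBounded Ω)
    (hx₀ : x₀ ∈ Ω)
    (m : ℕ) (α : ℤ → ℂ)
    (hzero : ∀ x ∈ frontier Ω, ∑ k ∈ Finset.Icc (-(m : ℤ)) (m : ℤ), α k * q k x = 0) :
    ∀ k : ℤ, |k| ≤ (m : ℤ) → α k = 0 := by
  let s := Finset.Icc (-(m : ℤ)) (m : ℤ)
  let P : ℝ → ℂ := fun φ => ∑ k ∈ s, α k * Complex.exp (Complex.I * k * φ)
  have hP : Continuous P := by fun_prop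
  have hfr : ∀ x ∈ frontier Ω, planeWaveIntegral P ((x - x₀) 0) ((x - x₀) 1) = 0 := by
    intro x hx
    have hne : x ≠ x₀ := by
      rintro rfl
      exact (hΩo.frontier_eq ▸ hx).2 hx₀
    obtain ⟨-, h0, h1⟩ := hθ x hne
    rw [h0, h1, planeWaveIntegral_trigPolynomial, ← mul_zero (2 * (Real.pi : ℂ)), ← hzero x hx]
    simp only [hq, if_neg hne]
    rfl
  have hΩ := planeWaveIntegral_eq_zero_of_frontier hP hΩo hΩb hfr
  obtain ⟨r, hr, hball⟩ := Metric.nhds_basis_closedBall.mem_iff.1 (hΩo.mem_nhds hx₀)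
  have hcircle (t : ℝ) :
      ∑ k ∈ s, α k * besselI k.natAbs r * Complex.exp (Complex.I * k * t) = 0 := by
    have h := hΩ _ (hball (polarPoint_mem_closedBall x₀ hr.le t))
    simp only [polarPoint, add_sub_cancel_left, PiLp.toLp_apply, Matrix.cons_val_zero,
      Matrix.cons_val_one] at h
    rw [planeWaveIntegral_trigPolynomial] at h
    have hpi : 2 * (Real.pi : ℂ) ≠ 0 := by simp [Real.pi_ne_zero]
    simpa only [mul_assoc] using (mul_eq_zero.1 h).resolve_left hpi
  intro k hk
  have h := eq_zero_of_forall_sum_cexp_eq_zero s (fun k => α k * besselI k.natAbs r) hcircle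
    (Finset.mem_Icc.2 (abs_le.1 hk))
  exact (mul_eq_zero.1 h).resolve_right (by exact_mod_cast (besselI_pos_s18 k.natAbs hr).ne')
end
end

section
/- Fix x₀ ∈ ℝ², and for k ∈ ℤ define p_k : ℝ² → ℂ by p_k(x) = |x − x₀|^{|k|} · exp(i k θ(x)) for x ≠ x₀ (where θ(x) is the polar angle of x − x₀) and p_k(x₀) = 0 for k ≠ 0, p_0(x₀) = 1. Let Ω ⊆ ℝ² be a bounded open set with x₀ ∈ Ω, let m be a natural number, and let (α_k)_{|k| ≤ m} be complex numbers such that Σ_{|k| ≤ m} α_k p_k(x) = 0 for every x in the boundary of Ω. Then α_k = 0 for every k with |k| ≤ m. In other words, the boundary restrictions {p_k|_{∂Ω} : |k| ≤ m} are linearly independent. -/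
noncomputable section

open Real MeasureTheory Complex Classical

/-- A polynomial whose real part vanishes on the boundary of a nonempty bounded open set is a
purely imaginary constant. -/
theorem Polynomial.eq_C_of_re_eq_zero_on_frontier {U : Set ℂ} (hUo : IsOpen U)
    (hUb : Bornology.IsBounded U) (hU : U.Nonempty) (F : Polynomial ℂ)
    (hF : ∀ z ∈ frontier U, (F.eval z).re = 0) :
    ∃ c : ℂ, c.re = 0 ∧ F = Polynomial.C c := by
  have re_nonpos (G : Polynomial ℂ) (hG : ∀ z ∈ frontier U, (G.eval z).re = 0) (z : ℂ)
      (hz : z ∈ U) : (G.eval z).re ≤ 0 := by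
    have h := Complex.norm_le_of_forall_mem_frontier_norm_le (f := fun w => Complex.exp (G.eval w))
      (C := 1) hUb (G.differentiable.cexp.diffContOnCl)
      (fun w hw => by simp [Complex.norm_exp, hG w hw]) (subset_closure hz)
    simpa [Complex.norm_exp] using h
  have hre : ∀ z ∈ U, (F.eval z).re = 0 := fun z hz =>
    le_antisymm (re_nonpos F hF z hz) (by
      simpa using re_nonpos (-F) (fun w hw => by simp [hF w hw]) z hz)
  have hconst : ∃ w, ∀ z, F.eval z = w := by
    have han : AnalyticOnNhd ℂ (fun z => F.eval z) Set.univ :=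
      F.differentiable.differentiableOn.analyticOnNhd isOpen_univ
    rcases han.is_constant_or_isOpen isPreconnected_univ with ⟨w, hw⟩ | hopen
    · exact ⟨w, fun z => hw z trivial⟩
    · exfalso
      have hsub : (fun z => F.eval z) '' U ⊆ interior {w : ℂ | w.re ≤ 0} :=
        interior_maximal (by rintro _ ⟨z, hz, rfl⟩; exact (hre z hz).le)
          (hopen U (Set.subset_univ U) hUo)
      obtain ⟨z, hz⟩ := hU
      have h := hsub ⟨z, hz, rfl⟩
      rw [Complex.interior_setOfPred_re_le] at h
      exact (ne_of_lt h) (hre z hz)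
  obtain ⟨w, hw⟩ := hconst
  obtain ⟨z, hz⟩ := hU
  exact ⟨w, by rw [← hw z, hre z hz], Polynomial.funext fun z => by simp [hw z]⟩

/-- The polynomial `∑_{|k| ≤ m} β_k X^{|k|}`. -/
def foldedPolynomial (m : ℕ) (β : ℤ → ℂ) : Polynomial ℂ :=
  ∑ k ∈ Finset.Icc (-(m : ℤ)) m, Polynomial.C (β k) * Polynomial.X ^ k.natAbs

theorem foldedPolynomial_eval (m : ℕ) (β : ℤ → ℂ) (z : ℂ) :
    (foldedPolynomial m β).eval z = ∑ k ∈ Finset.Icc (-(m : ℤ)) m, β k * z ^ k.natAbs := by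
  simp [foldedPolynomial, Polynomial.eval_finsetSum]

theorem foldedPolynomial_coeff (m : ℕ) (β : ℤ → ℂ) (n : ℕ) :
    (foldedPolynomial m β).coeff n =
      ∑ k ∈ Finset.Icc (-(m : ℤ)) m with n = k.natAbs, β k := by
  simp [foldedPolynomial, Polynomial.finsetSum_coeff, Polynomial.coeff_C_mul,
    Polynomial.coeff_X_pow, Finset.sum_filter]

theorem foldedPolynomial_coeff_zero (m : ℕ) (β : ℤ → ℂ) :
    (foldedPolynomial m β).coeff 0 = β 0 := by
  have h : (Finset.Icc (-(m : ℤ)) m).filter (fun k => 0 = k.natAbs) = {0} := by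
    ext k; simp only [Finset.mem_filter, Finset.mem_Icc, Finset.mem_singleton]; omega
  rw [foldedPolynomial_coeff, h, Finset.sum_singleton]

theorem foldedPolynomial_coeff_of_pos {m n : ℕ} (β : ℤ → ℂ) (hn : 0 < n) (hnm : n ≤ m) :
    (foldedPolynomial m β).coeff n = β n + β (-n) := by
  have h : (Finset.Icc (-(m : ℤ)) m).filter (fun k => n = k.natAbs) = {(n : ℤ), -(n : ℤ)} := by
    ext k
    simp only [Finset.mem_filter, Finset.mem_Icc, Finset.mem_insert, Finset.mem_singleton]; omega
  rw [foldedPolynomial_coeff, h, Finset.sum_pair (by omega)]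

/-- The harmonic polynomial `z ^ k` for `k ≥ 0` and `conj z ^ |k|` for `k < 0`. -/
def harmonicMonomial (k : ℤ) (z : ℂ) : ℂ :=
  if 0 ≤ k then z ^ k.natAbs else (starRingEnd ℂ) z ^ k.natAbs

theorem harmonicMonomial_zero (k : ℤ) : harmonicMonomial k 0 = if k = 0 then 1 else 0 := by
  simp [harmonicMonomial, zero_pow_eq]

theorem harmonicMonomial_polar (k : ℤ) (r t : ℝ) :
    harmonicMonomial k (r * Complex.exp (t * Complex.I)) =
      ((r ^ k.natAbs : ℝ) : ℂ) * Complex.exp (Complex.I * k * t) := by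
  unfold harmonicMonomial
  split_ifs with hk
  · have : ((k.natAbs : ℕ) : ℂ) = k := by
      rw [← Int.cast_natCast, Int.natAbs_of_nonneg hk]
    rw [mul_pow, ← Complex.exp_nat_mul, this]
    push_cast
    ring_nf
  · have : ((k.natAbs : ℕ) : ℂ) = -k := by
      rw [← Int.cast_natCast, Int.ofNat_natAbs_of_nonpos (by omega)]
      push_cast
      rfl
    rw [map_mul, ← Complex.exp_conj, map_mul, Complex.conj_ofReal, Complex.conj_ofReal,
      Complex.conj_I, mul_pow, ← Complex.exp_nat_mul, this]
    push_cast
    ring_nf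

theorem re_mul_harmonicMonomial (a : ℂ) (k : ℤ) (z : ℂ) :
    (a * harmonicMonomial k z).re =
      ((if 0 ≤ k then a else (starRingEnd ℂ) a) * z ^ k.natAbs).re := by
  unfold harmonicMonomial
  split_ifs
  · rfl
  · rw [← Complex.conj_re, map_mul, map_pow, Complex.conj_conj]

theorem im_mul_harmonicMonomial (a : ℂ) (k : ℤ) (z : ℂ) :
    (a * harmonicMonomial k z).im =
      ((if 0 ≤ k then a else -(starRingEnd ℂ) a) * z ^ k.natAbs).im := by
  unfold harmonicMonomial
  split_ifs
  · rfl
  · rw [neg_mul, Complex.neg_im, ← Complex.conj_im, map_mul, map_pow, Complex.conj_conj]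

/-- The boundary restrictions of the harmonic monomials are linearly independent. -/
theorem eq_zero_of_sum_harmonicMonomial_eq_zero_on_frontier {U : Set ℂ} (hUo : IsOpen U)
    (hUb : Bornology.IsBounded U) (hU : U.Nonempty) (m : ℕ) (α : ℤ → ℂ)
    (hzero : ∀ z ∈ frontier U,
      ∑ k ∈ Finset.Icc (-(m : ℤ)) m, α k * harmonicMonomial k z = 0)
    {k : ℤ} (hk : |k| ≤ m) : α k = 0 := by
  obtain ⟨c, hc, hFc⟩ := Polynomial.eq_C_of_re_eq_zero_on_frontier hUo hUb hU
    (foldedPolynomial m fun k => if 0 ≤ k then α k else (starRingEnd ℂ) (α k)) (fun z hz => by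
      rw [foldedPolynomial_eval, Complex.re_sum]
      simp_rw [← re_mul_harmonicMonomial]
      rw [← Complex.re_sum, hzero z hz, Complex.zero_re])
  obtain ⟨d, hd, hGd⟩ := Polynomial.eq_C_of_re_eq_zero_on_frontier hUo hUb hU
    (Polynomial.C Complex.I *
      foldedPolynomial m fun k => if 0 ≤ k then α k else -(starRingEnd ℂ) (α k)) (fun z hz => by
      rw [Polynomial.eval_mul, Polynomial.eval_C, Complex.I_mul_re, foldedPolynomial_eval,
        Complex.im_sum]
      simp_rw [← im_mul_harmonicMonomial]
      rw [← Complex.im_sum, hzero z hz, Complex.zero_im, neg_zero])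
  rcases Nat.eq_zero_or_pos k.natAbs with h0 | hpos
  · obtain rfl : k = 0 := by omega
    have h1 := congrArg (fun P => (Polynomial.coeff P 0).re) hFc
    have h2 := congrArg (fun P => (Polynomial.coeff P 0).re) hGd
    simp only [Polynomial.coeff_C_mul, foldedPolynomial_coeff_zero, le_refl, if_true,
      Polynomial.coeff_C_zero, hc, hd, Complex.I_mul_re, neg_eq_zero] at h1 h2
    exact Complex.ext h1 h2
  · have hkm : k.natAbs ≤ m := by rw [Int.abs_eq_natAbs] at hk; omega
    have h1 := congrArg (fun P => Polynomial.coeff P k.natAbs) hFc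
    have h2 := congrArg (fun P => Polynomial.coeff P k.natAbs) hGd
    have hneg : ¬ (0 : ℤ) ≤ -(k.natAbs : ℤ) := by omega
    simp only [Polynomial.coeff_C_mul, foldedPolynomial_coeff_of_pos _ hpos hkm,
      Polynomial.coeff_C_of_ne_zero hpos.ne', Int.natCast_nonneg, if_true, if_neg hneg,
      mul_eq_zero, Complex.I_ne_zero, false_or] at h1 h2
    rcases Int.natAbs_eq k with hk' | hk'
    · rw [hk']
      linear_combination (h1 + h2) / 2
    · rw [hk', ← map_eq_zero (starRingEnd ℂ)]
      linear_combination (h1 - h2) / 2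

/-- **Linear independence of the boundary restrictions of the family `{P_k}`**:
if a finite linear combination `Σ_{|k| ≤ m} α_k p_k`, with
`p_k(x) = |x − x₀|^{|k|} e^{i k θ(x)}`, vanishes on the boundary of a bounded open set
`Ω ∋ x₀`, then all coefficients vanish. -/
theorem pk_boundary_linear_independence
    (x₀ : EuclideanSpace ℝ (Fin 2))
    (θ : EuclideanSpace ℝ (Fin 2) → ℝ)
    (hθ : ∀ x, x ≠ x₀ → θ x ∈ Set.Ico (0 : ℝ) (2 * Real.pi) ∧
      (x - x₀) 0 = ‖x - x₀‖ * Real.cos (θ x) ∧ (x - x₀) 1 = ‖x - x₀‖ * Real.sin (θ x))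
    (p : ℤ → EuclideanSpace ℝ (Fin 2) → ℂ)
    (hp : ∀ (k : ℤ) (x : EuclideanSpace ℝ (Fin 2)),
      p k x = if x = x₀ then (if k = 0 then 1 else 0)
        else ((‖x - x₀‖ ^ k.natAbs : ℝ) : ℂ) * Complex.exp (Complex.I * (k : ℂ) * (θ x : ℂ)))
    (Ω : Set (EuclideanSpace ℝ (Fin 2))) (hΩo : IsOpen Ω) (hΩb : Bornology.IsBounded Ω)
    (hx₀ : x₀ ∈ Ω)
    (m : ℕ) (α : ℤ → ℂ)
    (hzero : ∀ x ∈ frontier Ω, ∑ k ∈ Finset.Icc (-(m : ℤ)) (m : ℤ), α k * p k x = 0) :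
    ∀ k : ℤ, |k| ≤ (m : ℤ) → α k = 0 := by
  intro k hk
  let e : ℂ ≃ᵢ EuclideanSpace ℝ (Fin 2) :=
    Complex.orthonormalBasisOneI.repr.toIsometryEquiv.trans (IsometryEquiv.addRight x₀)
  have he (z : ℂ) : e z - x₀ = Complex.orthonormalBasisOneI.repr z := by simp [e]
  have he0 : e 0 = x₀ := by simp [e]
  have hpe (k : ℤ) (z : ℂ) : p k (e z) = harmonicMonomial k z := by
    rw [hp]
    split_ifs with hz hk
    · obtain rfl : z = 0 := e.injective (hz.trans he0.symm)
      simp [harmonicMonomial_zero, hk]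
    · obtain rfl : z = 0 := e.injective (hz.trans he0.symm)
      simp [harmonicMonomial_zero, hk]
    · obtain ⟨-, hcos, hsin⟩ := hθ (e z) hz
      rw [← harmonicMonomial_polar]
      congr 1
      rw [Complex.exp_mul_I, ← Complex.ofReal_cos, ← Complex.ofReal_sin]
      rw [he] at hcos hsin ⊢
      apply Complex.ext
      · simpa [Complex.cos_ofReal_re] using hcos.symm
      · simpa [Complex.sin_ofReal_re] using hsin.symm
  refine eq_zero_of_sum_harmonicMonomial_eq_zero_on_frontier (U := e ⁻¹' Ω)
    (hΩo.preimage e.continuous) (e.isometry.antilipschitz.isBounded_preimage hΩb)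
    ⟨0, by simpa [he0] using hx₀⟩ m α (fun z hz => ?_) hk
  simp_rw [← hpe]
  refine hzero (e z) ?_
  rwa [← e.coe_toHomeomorph, ← Homeomorph.preimage_frontier] at hz
end
end
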